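/- Let γ ≥ (2+α)/(2−α) and let g : ∂B → ℝ be continuous, nonnegative and not identically zero. Then problem (P_g) has no solution. -/

import Mathlib

open MeasureTheory Real Filter Topology Metric Set

noncomputable section

abbrev EN (N : ℕ) := EuclideanSpace ℝ (Fin N)

/-- The normalizing constant `c_{N,α}` of the fractional Laplacian. -/
def fracLapCoeff (N : ℕ) (α : ℝ) : ℝ :=
  2 ^ α * Real.pi ^ (-(N : ℝ) / 2) * Real.Gamma (((N : ℝ) + α) / 2) / |Real.Gamma (-α / 2)|

/-- `HasFracLap N α u x L` means the principal-value limit defining `Δ^{α/2} u (x)` exists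
and equals `L`. -/
def HasFracLap (N : ℕ) (α : ℝ) (u : EN N → ℝ) (x : EN N) (L : ℝ) : Prop :=
  Tendsto (fun ε : ℝ =>
      fracLapCoeff N α * ∫ y in {y : EN N | ε < dist y x}, (u y - u x) / dist y x ^ ((N : ℝ) + α))
    (𝓝[>] (0 : ℝ)) (𝓝 L)

/-- The value of the fractional Laplacian at `x` (junk value `0` where the limit fails). -/
def fracLap (N : ℕ) (α : ℝ) (u : EN N → ℝ) (x : EN N) : ℝ :=
  haveI := Classical.propDecidable (∃ L, HasFracLap N α u x L)
  if h : ∃ L, HasFracLap N α u x L then h.choose else 0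

/-- The weighted space `𝓛_α`. -/
def memLalpha (N : ℕ) (α : ℝ) (u : EN N → ℝ) : Prop :=
  Integrable (fun y : EN N => u y * (1 + ‖y‖) ^ (-((N : ℝ) + α)))

/-- `δ(x) = 1 - |x|` on the unit ball, `0` outside. -/
def delta1 {N : ℕ} (x : EN N) : ℝ := if ‖x‖ < 1 then 1 - ‖x‖ else 0

/-- The constant `κ_{N,α}`. -/
def greenCoeff (N : ℕ) (α : ℝ) : ℝ :=
  Real.Gamma ((N : ℝ) / 2) / (2 ^ α * Real.pi ^ ((N : ℝ) / 2) * Real.Gamma (α / 2) ^ 2)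

/-- The Green function of the unit ball. -/
def greenB (N : ℕ) (α : ℝ) (x y : EN N) : ℝ :=
  if ‖x‖ < 1 ∧ ‖y‖ < 1 then
    greenCoeff N α * ‖x - y‖ ^ (α - (N : ℝ)) *
      ∫ s in (0:ℝ)..((1 - ‖x‖ ^ 2) * (1 - ‖y‖ ^ 2) / ‖x - y‖ ^ 2),
        s ^ (α / 2 - 1) * (1 + s) ^ (-(N : ℝ) / 2)
  else 0

/-- The Green function of the ball `B(a,r)`, by scaling. -/
def greenBall (N : ℕ) (α : ℝ) (a : EN N) (r : ℝ) (x y : EN N) : ℝ :=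
  r ^ (α - (N : ℝ)) * greenB N α (r⁻¹ • (x - a)) (r⁻¹ • (y - a))

/-- The constant `c_α^N` of the Poisson kernel. -/
def poissonCoeff (N : ℕ) (α : ℝ) : ℝ :=
  Real.pi ^ (-1 - (N : ℝ) / 2) * Real.Gamma ((N : ℝ) / 2) * Real.sin (Real.pi * α / 2)

/-- The Poisson kernel of the ball `B(a,r)`. -/
def poissonBall (N : ℕ) (α : ℝ) (a : EN N) (r : ℝ) (x y : EN N) : ℝ :=
  poissonCoeff N α * ((r ^ 2 - ‖x - a‖ ^ 2) / (‖y - a‖ ^ 2 - r ^ 2)) ^ (α / 2) *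
    ‖x - y‖ ^ (-(N : ℝ))

/-- The harmonic-measure operator `H^α_{B(a,r)} f`. -/
def Hball (N : ℕ) (α : ℝ) (a : EN N) (r : ℝ) (f : EN N → ℝ) (x : EN N) : ℝ :=
  ∫ y in {y : EN N | r < ‖y - a‖}, poissonBall N α a r x y * f y

/-- Solution (in the distributional sense) of `Δ^{α/2} u = u^γ` in the open set `U`. -/
def IsSolution (N : ℕ) (α γ : ℝ) (U : Set (EN N)) (u : EN N → ℝ) : Prop :=
  (∀ x, 0 ≤ u x) ∧ ContinuousOn u U ∧ memLalpha N α u ∧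
    ∀ φ : EN N → ℝ, ContDiff ℝ (⊤ : ℕ∞) φ → HasCompactSupport φ → tsupport φ ⊆ U →
      (∀ x, 0 ≤ φ x) →
        ∫ x, u x * fracLap N α φ x = ∫ x, u x ^ γ * φ x

/-- The surface measure `σ` on the unit sphere. -/
def sphereMeasure (N : ℕ) : Measure (Metric.sphere (0 : EN N) 1) :=
  (volume : Measure (EN N)).toSphere

/-- The Martin integral `M_B^α g`. -/
def martinB (N : ℕ) (α : ℝ) (g : Metric.sphere (0 : EN N) 1 → ℝ) (x : EN N) : ℝ :=
  if ‖x‖ < 1 then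
    ∫ y, (1 - ‖x‖ ^ 2) ^ (α / 2) * ‖x - (y : EN N)‖ ^ (-(N : ℝ)) * g y ∂(sphereMeasure N)
  else 0

/-- Solution of the moderate blow-up problem `(P_g)`. -/
def IsSolutionPg (N : ℕ) (α γ : ℝ) (g : Metric.sphere (0 : EN N) 1 → ℝ) (u : EN N → ℝ) : Prop :=
  (∀ x, 0 ≤ u x) ∧ memLalpha N α u ∧ (∀ x : EN N, ¬ ‖x‖ < 1 → u x = 0) ∧
    IsSolution N α γ (Metric.ball (0 : EN N) 1) u ∧
    ∀ z : Metric.sphere (0 : EN N) 1,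
      Tendsto (fun x => delta1 x ^ (1 - α / 2) * u x)
        (𝓝[Metric.ball (0 : EN N) 1] (z : EN N)) (𝓝 (g z))

/-- Solution of the blow-up problem `(P_∞)`. -/
def IsSolutionPinf (N : ℕ) (α γ : ℝ) (u : EN N → ℝ) : Prop :=
  (∀ x, 0 ≤ u x) ∧ memLalpha N α u ∧ (∀ x : EN N, ¬ ‖x‖ < 1 → u x = 0) ∧
    IsSolution N α γ (Metric.ball (0 : EN N) 1) u ∧
    ∀ z : Metric.sphere (0 : EN N) 1,
      Tendsto (fun x => delta1 x ^ (1 - α / 2) * u x)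
        (𝓝[Metric.ball (0 : EN N) 1] (z : EN N)) atTop



def Sf (β a : ℝ) : ℝ := max (1 + a) 0 ^ β + max (1 - a) 0 ^ β - 2

lemma Sf_neg (β a : ℝ) : Sf β (-a) = Sf β a := by
  unfold Sf; rw [← sub_eq_add_neg, sub_neg_eq_add]; ring

lemma Sf_abs (β a : ℝ) : Sf β |a| = Sf β a := by
  rcases abs_choice a with h | h <;> rw [h]
  exact Sf_neg β a

lemma Sf_zero (β : ℝ) : Sf β 0 = 0 := by
  simp [Sf]; norm_num

lemma Sf_cont (β : ℝ) (hβ : 0 < β) : Continuous (Sf β) := by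
  unfold Sf
  have h1 : Continuous fun a : ℝ => max (1 + a) 0 ^ β :=
    Continuous.rpow_const (by fun_prop) (fun _ => Or.inr hβ.le)
  have h2 : Continuous fun a : ℝ => max (1 - a) 0 ^ β :=
    Continuous.rpow_const (by fun_prop) (fun _ => Or.inr hβ.le)
  exact (h1.add h2).sub continuous_const

lemma Sf_small (β a : ℝ) (hβ : 0 < β) (hβ1 : β < 1) (h0 : 0 ≤ a) (h1 : a ≤ 1) :
    |Sf β a| ≤ 2 * a ^ 2 := by
  unfold Sf
  rw [max_eq_left (by linarith), max_eq_left (by linarith)]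
  have hA : (1 + a) ^ β ≤ 1 + β * a :=
    rpow_one_add_le_one_add_mul_self (by linarith) hβ.le hβ1.le
  have hB : (1 + (-a)) ^ β ≤ 1 + β * (-a) :=
    rpow_one_add_le_one_add_mul_self (by linarith) hβ.le hβ1.le
  rw [← sub_eq_add_neg] at hB
  have hX : 0 ≤ (1 + a) ^ (β/2) := by positivity
  have hY : 0 ≤ (1 - a) ^ (β/2) := Real.rpow_nonneg (by linarith) _
  have e1 : (1 + a) ^ β = ((1 + a) ^ (β/2)) ^ 2 := by
    rw [← Real.rpow_natCast, ← Real.rpow_mul (by linarith)]; norm_num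
  have e2 : (1 - a) ^ β = ((1 - a) ^ (β/2)) ^ 2 := by
    rw [← Real.rpow_natCast, ← Real.rpow_mul (by linarith)]; norm_num
  have e3 : (1 + a) ^ (β/2) * (1 - a) ^ (β/2) = (1 - a ^ 2) ^ (β/2) := by
    rw [← Real.mul_rpow (by linarith) (by linarith)]; ring_nf
  have e4 : (1 - a ^ 2) ≤ (1 - a ^ 2) ^ (β/2) := by
    have := Real.rpow_le_rpow_of_exponent_ge' (x := 1 - a^2) (y := 1) (z := β/2)
      (by nlinarith) (by nlinarith) (by linarith) (by linarith)
    simpa using this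
  have := sq_nonneg ((1 + a) ^ (β/2) - (1 - a) ^ (β/2))
  rw [abs_le]; constructor
  · nlinarith
  · nlinarith [sq_nonneg a]

lemma Sf_large (β a : ℝ) (hβ : 0 < β) (hβ1 : β < 1) (h1 : 1 ≤ a) :
    |Sf β a| ≤ 2 * a ^ β := by
  unfold Sf
  rw [max_eq_left (by linarith : (0:ℝ) ≤ 1 + a), max_eq_right (by linarith : 1 - a ≤ 0),
    Real.zero_rpow hβ.ne']
  have hA : (1 + a) ^ β ≤ (2 * a) ^ β := Real.rpow_le_rpow (by linarith) (by linarith) hβ.le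
  rw [Real.mul_rpow (by norm_num) (by linarith)] at hA
  have h2 : (2:ℝ) ^ β ≤ 2 ^ (1:ℝ) := Real.rpow_le_rpow_of_exponent_le (by norm_num) hβ1.le
  rw [Real.rpow_one] at h2
  have h3 : 1 ≤ a ^ β := Real.one_le_rpow h1 hβ.le
  have h4 : 0 ≤ (1 + a) ^ β := by positivity
  rw [abs_le]; constructor <;> nlinarith

lemma Sk_integrable (β : ℝ) (hβ : 0 < β) (hβ1 : β < 1) :
    IntegrableOn (fun a => Sf β a * a ^ (-1 - 2 * β)) (Ioi 0) := by
  have hm : ∀ s : Set ℝ, AEStronglyMeasurable (fun a => Sf β a * a ^ (-1 - 2 * β))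
      (volume.restrict s) := fun s =>
    ((Sf_cont β hβ).measurable.mul (measurable_id.pow_const _)).aestronglyMeasurable
  rw [← Ioc_union_Ioi_eq_Ioi (zero_le_one (α := ℝ)), integrableOn_union]
  constructor
  · have hi : IntegrableOn (fun a : ℝ => 2 * a ^ (1 - 2 * β)) (Ioc 0 1) := by
      refine Integrable.const_mul ?_ _
      exact (intervalIntegral.intervalIntegrable_rpow' (by linarith)).1
    refine hi.mono' (hm _) ?_
    filter_upwards [ae_restrict_mem measurableSet_Ioc] with a ha
    rw [norm_mul, Real.norm_eq_abs, Real.norm_eq_abs, abs_of_nonneg (Real.rpow_nonneg ha.1.le _)]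
    calc _ ≤ (2 * a ^ 2) * a ^ (-1 - 2 * β) := by
          gcongr
          · exact Real.rpow_nonneg ha.1.le _
          · exact Sf_small β a hβ hβ1 ha.1.le ha.2
      _ = _ := by
          rw [mul_assoc, ← Real.rpow_natCast, ← Real.rpow_add ha.1]; congr 2; push_cast; ring
  · have hi : IntegrableOn (fun a : ℝ => 2 * a ^ (-1 - β)) (Ioi 1) := by
      refine Integrable.const_mul ?_ _
      exact integrableOn_Ioi_rpow_of_lt (by linarith) (by norm_num)
    refine hi.mono' (hm _) ?_
    filter_upwards [ae_restrict_mem measurableSet_Ioi] with a ha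
    have ha' : (1:ℝ) < a := ha
    have ha0 : 0 < a := by linarith
    rw [norm_mul, Real.norm_eq_abs, Real.norm_eq_abs, abs_of_nonneg (Real.rpow_nonneg ha0.le _)]
    calc _ ≤ (2 * a ^ β) * a ^ (-1 - 2 * β) := by
          gcongr
          exact Sf_large β a hβ hβ1 ha'.le
      _ = _ := by
          rw [mul_assoc, ← Real.rpow_add ha0]; congr 2; ring

lemma G_int (β κ R : ℝ) (hβ : 0 < β) (hβ1 : β < 1) (hκ : 0 < κ) (hR : κ < R) :
    (∫ b in κ..R, ((1 + b) ^ β - 1) * (1 - (1 + b) ^ (β - 1)) * b ^ (-1 - 2 * β)) ≤ 1 / (2 * β) := by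
  have hpos : ∀ b ∈ uIcc κ R, 0 < b := by
    intro b hb; rw [uIcc_of_le hR.le] at hb; linarith [hb.1]
  have hd : ∀ b ∈ uIcc κ R, HasDerivAt
      (fun b : ℝ => (1 / (2 * β)) * (((1 + b) ^ β - 1) ^ 2 * b ^ (-(2 * β))))
      (((1 + b) ^ β - 1) * (1 - (1 + b) ^ (β - 1)) * b ^ (-1 - 2 * β)) b := by
    intro b hb
    have hb0 := hpos b hb
    have h1 : HasDerivAt (fun b : ℝ => (1 + b) ^ β) (1 * β * (1 + b) ^ (β - 1)) b := by
      have : HasDerivAt (fun b : ℝ => 1 + b) 1 b := by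
        simpa using (hasDerivAt_id b).const_add 1
      exact this.rpow_const (Or.inl (by linarith))
    have h2 : HasDerivAt (fun b : ℝ => b ^ (-(2 * β))) (-(2 * β) * b ^ (-(2 * β) - 1)) b :=
      Real.hasDerivAt_rpow_const (Or.inl hb0.ne')
    have h3 := (((h1.sub_const 1).pow 2).mul h2).const_mul (1 / (2 * β))
    refine h3.congr_deriv ?_
    have e1 : b ^ (-(2 * β)) = b * b ^ (-1 - 2 * β) := by
      nth_rewrite 2 [← Real.rpow_one b]
      rw [← Real.rpow_add hb0]; congr 1; ring
    have e2 : (1 + b) ^ β = (1 + b) * (1 + b) ^ (β - 1) := by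
      nth_rewrite 2 [← Real.rpow_one (1 + b)]
      rw [← Real.rpow_add (by linarith)]; congr 1; ring
    have e3 : b ^ (-(2 * β) - 1) = b ^ (-1 - 2 * β) := by congr 1; ring
    simp only [Pi.pow_apply]
    rw [e1, e3, e2]
    field_simp
    push_cast
    ring
  have hc : ContinuousOn (fun b : ℝ => ((1 + b) ^ β - 1) * (1 - (1 + b) ^ (β - 1)) *
      b ^ (-1 - 2 * β)) (uIcc κ R) := by
    refine ContinuousOn.mul (ContinuousOn.mul ?_ ?_) ?_
    · refine ContinuousOn.sub (ContinuousOn.rpow_const (by fun_prop) ?_) continuousOn_const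
      intro b hb; left; linarith [hpos b hb]
    · refine ContinuousOn.sub continuousOn_const (ContinuousOn.rpow_const (by fun_prop) ?_)
      intro b hb; left; linarith [hpos b hb]
    · refine ContinuousOn.rpow_const (by fun_prop) ?_
      intro b hb; left; exact (hpos b hb).ne'
  rw [intervalIntegral.integral_eq_sub_of_hasDerivAt hd hc.intervalIntegrable]
  have hR0 : 0 < R := hκ.trans hR
  have hA : 0 ≤ (1 / (2 * β)) * (((1 + κ) ^ β - 1) ^ 2 * κ ^ (-(2 * β))) := by positivity
  have hB : ((1 + R) ^ β - 1) ^ 2 * R ^ (-(2 * β)) ≤ 1 := by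
    have s1 : (1 + R) ^ β ≤ 1 ^ β + R ^ β := Real.rpow_add_le_add_rpow (by norm_num) hR0.le hβ.le hβ1.le
    have s2 : 1 ≤ (1 + R) ^ β := Real.one_le_rpow (by linarith) hβ.le
    rw [Real.one_rpow] at s1
    have s3 : ((1 + R) ^ β - 1) ^ 2 ≤ (R ^ β) ^ 2 := by
      apply pow_le_pow_left₀ <;> linarith
    calc _ ≤ (R ^ β) ^ 2 * R ^ (-(2 * β)) := by gcongr
      _ = 1 := by
        rw [← Real.rpow_natCast, ← Real.rpow_mul hR0.le, ← Real.rpow_add hR0]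
        push_cast
        rw [show β * 2 + -(2 * β) = 0 by ring, Real.rpow_zero]
  have : (1 / (2 * β)) * (((1 + R) ^ β - 1) ^ 2 * R ^ (-(2 * β))) ≤ (1 / (2 * β)) * 1 := by
    gcongr
  linarith

lemma subst_int (β κ R : ℝ) (hκ : 0 < κ) (hR : κ < R) :
    (∫ a in (κ / (1 + κ))..(R / (1 + R)), ((1 - a) ^ β - 1) * a ^ (-1 - 2 * β)) =
    ∫ b in κ..R, ((1 + b) ^ (-β) - 1) * (1 + b) ^ (2 * β - 1) * b ^ (-1 - 2 * β) := by
  have hpos : ∀ b ∈ uIcc κ R, 0 < b := by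
    intro b hb; rw [uIcc_of_le hR.le] at hb; linarith [hb.1]
  have key := intervalIntegral.integral_comp_mul_deriv_of_deriv_nonneg (a := κ) (b := R)
    (f := fun b => b / (1 + b)) (f' := fun b => 1 / (1 + b) ^ 2)
    (g := fun a => ((1 - a) ^ β - 1) * a ^ (-1 - 2 * β)) ?_ ?_ ?_
  · rw [← key]
    apply intervalIntegral.integral_congr
    intro b hb
    have hb0 := hpos b hb
    have hb1 : 0 < 1 + b := by linarith
    simp only [Function.comp]
    have e1 : 1 - b / (1 + b) = (1 + b)⁻¹ := by field_simp; ring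
    rw [e1, Real.inv_rpow hb1.le, ← Real.rpow_neg hb1.le, Real.div_rpow hb0.le hb1.le]
    have e2 : (1 + b) ^ (2 * β - 1) = ((1 + b) ^ (-1 - 2 * β))⁻¹ * (1 / (1 + b) ^ 2) := by
      rw [← Real.rpow_neg hb1.le, one_div, ← Real.rpow_natCast, ← Real.rpow_neg hb1.le,
        ← Real.rpow_add hb1]
      congr 1; push_cast; ring
    rw [e2]; field_simp
  · apply ContinuousOn.div (by fun_prop) (by fun_prop)
    intro b hb; linarith [hpos b hb]
  · intro b hb
    rw [min_eq_left hR.le] at hb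
    have hb1 : 1 + b ≠ 0 := by linarith [hb.1]
    have h2 : HasDerivAt (fun b : ℝ => 1 + b) 1 b := by
        simpa using (hasDerivAt_id b).const_add 1
    refine ((hasDerivAt_id b).div h2 hb1).congr_deriv ?_
    simp
  · intro b hb; positivity

lemma Sk_trunc (β κ R : ℝ) (hβ : 0 < β) (hβ1 : β < 1) (hκ : 0 < κ) (hκ1 : κ ≤ 1 / 2) (hR : 1 < R) :
    (∫ a in κ..R, Sf β a * a ^ (-1 - 2 * β)) ≤
      R ^ (-(2 * β)) / (2 * β) + κ ^ 2 * (κ / 2) ^ (-(2 * β)) := by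
  set q : ℝ → ℝ := fun a => (max (1 - a) 0 ^ β - 1) * a ^ (-1 - 2 * β) with hq
  set p : ℝ → ℝ := fun a => ((1 + a) ^ β - 1) * a ^ (-1 - 2 * β) with hp
  have hκR : κ < R := by linarith
  set κ' := κ / (1 + κ) with hκ'
  set R' := R / (1 + R) with hR'
  have k1 : 0 < κ' := by positivity
  have k2 : κ' < κ := by rw [hκ', div_lt_iff₀ (by linarith)]; nlinarith
  have k3 : κ / 2 ≤ κ' := by rw [hκ', div_le_div_iff₀ (by linarith) (by linarith)]; nlinarith
  have k4 : κ - κ' ≤ κ ^ 2 := by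
    have : κ - κ' = κ ^ 2 / (1 + κ) := by rw [hκ']; field_simp; ring
    rw [this]; exact div_le_self (by positivity) (by linarith)
  have k5 : R' < 1 := by rw [hR', div_lt_one (by linarith)]; linarith
  have k6 : κ < R' := by
    have : 1/2 < R' := by rw [hR', div_lt_div_iff₀ (by norm_num) (by linarith)]; linarith
    linarith
  have qc : ∀ a b : ℝ, 0 < a → 0 < b → IntervalIntegrable q volume a b := by
    intro a b ha hb
    apply ContinuousOn.intervalIntegrable
    refine ContinuousOn.mul (ContinuousOn.sub (ContinuousOn.rpow_const (by fun_prop) ?_)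
      continuousOn_const) (ContinuousOn.rpow_const (by fun_prop) ?_)
    · intro _ _; right; exact hβ.le
    · intro c hc; left
      have : min a b ≤ c := hc.1
      have := lt_min ha hb
      simp only [ne_eq]; intro h; simp only [h] at *; linarith
  have pc : IntervalIntegrable p volume κ R := by
    apply ContinuousOn.intervalIntegrable
    rw [uIcc_of_le hκR.le]
    refine ContinuousOn.mul (ContinuousOn.sub (ContinuousOn.rpow_const (by fun_prop) ?_)
      continuousOn_const) (ContinuousOn.rpow_const (by fun_prop) ?_)
    · intro _ _; right; exact hβ.le
    · intro c hc; left; simp only [ne_eq]; intro h; rw [h] at hc; linarith [hc.1]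
  have h1 : (∫ a in κ..R, Sf β a * a ^ (-1 - 2 * β)) = (∫ a in κ..R, p a) + ∫ a in κ..R, q a := by
    rw [← intervalIntegral.integral_add pc (qc _ _ hκ (by linarith))]
    apply intervalIntegral.integral_congr
    intro a ha
    rw [uIcc_of_le hκR.le] at ha
    simp only [hp, hq, Sf]
    rw [max_eq_left (by linarith [ha.1] : (0:ℝ) ≤ 1 + a)]; ring
  have hR0 : 0 < R := by linarith
  have hR'0 : 0 < R' := by linarith
  have h2 : (∫ a in κ..R, q a) = (∫ a in κ'..R', q a) - (∫ a in κ'..κ, q a)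
      + (∫ a in R'..1, q a) + ∫ a in (1:ℝ)..R, q a := by
    have a1 := intervalIntegral.integral_add_adjacent_intervals (qc κ' κ k1 hκ) (qc κ R' hκ hR'0)
    have a2 := intervalIntegral.integral_add_adjacent_intervals (qc κ R' hκ hR'0) (qc R' 1 hR'0 one_pos)
    have a3 := intervalIntegral.integral_add_adjacent_intervals (qc κ 1 hκ one_pos) (qc 1 R one_pos hR0)
    linarith
  have h3 : (∫ a in R'..1, q a) ≤ 0 := by
    have : 0 ≤ ∫ a in R'..1, -(q a) := by
      apply intervalIntegral.integral_nonneg k5.le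
      intro a ha'
      have ha : 0 ≤ a := by linarith [ha'.1]
      have h0 : max (1 - a) 0 ^ β ≤ 1 := Real.rpow_le_one (le_max_right _ _) (by simp [ha]) hβ.le
      have h1 : (max (1 - a) 0 ^ β - 1) * a ^ (-1 - 2 * β) ≤ 0 :=
        mul_nonpos_of_nonpos_of_nonneg (by linarith) (Real.rpow_nonneg ha _)
      simp only [hq]; linarith
    rw [intervalIntegral.integral_neg] at this
    linarith
  have h4 : (∫ a in (1:ℝ)..R, q a) = -(1 - R ^ (-(2 * β))) / (2 * β) := by
    have : (∫ a in (1:ℝ)..R, q a) = ∫ a in (1:ℝ)..R, -(a ^ (-1 - 2 * β)) := by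
      apply intervalIntegral.integral_congr
      intro a ha
      rw [uIcc_of_le hR.le] at ha
      simp only [hq]
      rw [max_eq_right (by linarith [ha.1]), Real.zero_rpow hβ.ne']; ring
    rw [this, intervalIntegral.integral_neg, integral_rpow]
    · rw [show -1 - 2 * β + 1 = -(2 * β) by ring, Real.one_rpow]; field_simp; ring
    · right; refine ⟨by linarith, ?_⟩
      rw [uIcc_of_le hR.le]; intro h; linarith [h.1]
  have h5 : -(∫ a in κ'..κ, q a) ≤ κ ^ 2 * (κ / 2) ^ (-(2 * β)) := by
    rw [← intervalIntegral.integral_neg]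
    calc (∫ a in κ'..κ, - q a) ≤ ∫ a in κ'..κ, (κ / 2) ^ (-(2 * β)) := by
          apply intervalIntegral.integral_mono_on k2.le (qc _ _ k1 hκ).neg (by simp)
          intro a ha
          have ha0 : 0 < a := by linarith [ha.1]
          simp only [hq, Pi.neg_apply]
          rw [max_eq_left (by linarith [ha.2])]
          have b1 : 1 - a ≤ (1 - a) ^ β := by
            have := Real.rpow_le_rpow_of_exponent_ge' (x := 1 - a) (y := 1) (z := β)
              (by linarith [ha.2]) (by linarith) (by linarith) (by linarith)
            simpa using this
          have b2 : a * a ^ (-1 - 2 * β) = a ^ (-(2 * β)) := by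
            nth_rewrite 1 [← Real.rpow_one a]
            rw [← Real.rpow_add ha0]; congr 1; ring
          have b3 : a ^ (-(2 * β)) ≤ (κ / 2) ^ (-(2 * β)) :=
            Real.rpow_le_rpow_of_nonpos (by linarith) (by linarith [ha.1]) (by linarith)
          have b4 : 0 ≤ a ^ (-1 - 2 * β) := Real.rpow_nonneg ha0.le _
          nlinarith
      _ = (κ - κ') * (κ / 2) ^ (-(2 * β)) := by simp
      _ ≤ _ := by gcongr
  have h6 : (∫ a in κ..R, p a) + (∫ a in κ'..R', q a) ≤ 1 / (2 * β) := by
    have e : (∫ a in κ'..R', q a) = ∫ a in κ'..R', ((1 - a) ^ β - 1) * a ^ (-1 - 2 * β) := by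
      apply intervalIntegral.integral_congr
      intro a ha
      rw [uIcc_of_le (by linarith)] at ha
      simp only [hq]
      rw [max_eq_left (by linarith [ha.2])]
    have hcc : IntervalIntegrable (fun b : ℝ => ((1 + b) ^ (-β) - 1) * (1 + b) ^ (2 * β - 1) *
        b ^ (-1 - 2 * β)) volume κ R := by
      apply ContinuousOn.intervalIntegrable
      rw [uIcc_of_le hκR.le]
      have hne : ∀ c ∈ Icc κ R, 1 + c ≠ 0 := by intro c hc; linarith [hc.1]
      have hne' : ∀ c ∈ Icc κ R, c ≠ 0 := by intro c hc; linarith [hc.1]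
      refine ContinuousOn.mul (ContinuousOn.mul (ContinuousOn.sub
        (ContinuousOn.rpow_const (by fun_prop) fun c hc => Or.inl (hne c hc)) continuousOn_const)
        (ContinuousOn.rpow_const (by fun_prop) fun c hc => Or.inl (hne c hc)))
        (ContinuousOn.rpow_const (by fun_prop) fun c hc => Or.inl (hne' c hc))
    rw [e, subst_int β κ R hκ hκR, ← intervalIntegral.integral_add pc hcc]
    refine le_trans (le_of_eq ?_) (G_int β κ R hβ hβ1 hκ hκR)
    apply intervalIntegral.integral_congr
    intro b hb
    rw [uIcc_of_le hκR.le] at hb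
    have hb1 : 0 < 1 + b := by linarith [hb.1]
    simp only [hp]
    have e1 : (1 + b) ^ (2 * β - 1) = (1 + b) ^ β * (1 + b) ^ (β - 1) := by
      rw [← Real.rpow_add hb1]; congr 1; ring
    have e2 : (1 + b) ^ (-β) * (1 + b) ^ β = 1 := by
      rw [← Real.rpow_add hb1]; simp
    rw [e1]
    linear_combination (1 + b) ^ (β - 1) * b ^ (-1 - 2 * β) * e2
  have h7 : -(1 - R ^ (-(2 * β))) / (2 * β) = R ^ (-(2 * β)) / (2 * β) - 1 / (2 * β) := by ring
  linarith

lemma Sk_integral_nonpos (β : ℝ) (hβ : 0 < β) (hβ1 : β < 1) :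
    (∫ a in Ioi (0:ℝ), Sf β a * a ^ (-1 - 2 * β)) ≤ 0 := by
  let s : ℕ → Set ℝ := fun n => Ioc (1 / ((n:ℝ) + 2)) ((n:ℝ) + 2)
  have hU : (⋃ n, s n) = Ioi 0 := by
    ext a
    simp only [s, mem_iUnion, mem_Ioc, mem_Ioi]
    constructor
    · rintro ⟨n, h1, h2⟩
      exact lt_trans (by positivity) h1
    · intro ha
      obtain ⟨n, hn⟩ := exists_nat_gt (max a (1/a))
      refine ⟨n, ?_, ?_⟩
      · rw [div_lt_comm₀ (by positivity) ha]
        linarith [le_max_right a (1/a)]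
      · linarith [le_max_left a (1/a)]
  have hmono : Monotone s := by
    intro m n hmn
    have : (m:ℝ) ≤ n := by exact_mod_cast hmn
    apply Ioc_subset_Ioc
    · apply one_div_le_one_div_of_le (by positivity); linarith
    · linarith
  have ht := tendsto_setIntegral_of_monotone (f := fun a => Sf β a * a ^ (-1 - 2 * β))
    (μ := volume) (s := s) (fun n => measurableSet_Ioc) hmono (by rw [hU]; exact Sk_integrable β hβ hβ1)
  rw [hU] at ht
  have hb : Tendsto (fun n : ℕ => ((n:ℝ) + 2) ^ (-(2 * β)) / (2 * β)
      + 4 * ((n:ℝ) + 2) ^ (-(2 - 2 * β))) atTop (𝓝 (0 / (2 * β) + 4 * 0)) := by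
    have hn : Tendsto (fun n : ℕ => (n:ℝ) + 2) atTop atTop :=
      tendsto_atTop_add_const_right _ _ tendsto_natCast_atTop_atTop
    exact (((tendsto_rpow_neg_atTop (by linarith)).comp hn).div_const _).add
      (((tendsto_rpow_neg_atTop (by linarith)).comp hn).const_mul _)
  simp only [zero_div, mul_zero, add_zero] at hb
  refine le_of_tendsto_of_tendsto' ht hb fun n => ?_
  have hn : (0:ℝ) ≤ n := n.cast_nonneg
  have hpos : (0:ℝ) < n + 2 := by linarith
  have hle : 1 / ((n:ℝ) + 2) ≤ 1 / 2 := by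
    apply one_div_le_one_div_of_le <;> linarith
  have := Sk_trunc β (1 / ((n:ℝ) + 2)) (n + 2) hβ hβ1 (by positivity) hle (by linarith)
  rw [intervalIntegral.integral_of_le (by linarith)] at this
  refine this.trans ?_
  refine add_le_add le_rfl ?_
  have e1 : (1 / ((n:ℝ) + 2) / 2) ^ (-(2 * β)) = 2 ^ (2 * β) * ((n:ℝ) + 2) ^ (2 * β) := by
    rw [← Real.mul_rpow (by norm_num) hpos.le, div_div, one_div, Real.inv_rpow (by positivity),
      ← Real.rpow_neg (by positivity), neg_neg, mul_comm]
  have e2 : (2:ℝ) ^ (2 * β) ≤ 4 := by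
    calc (2:ℝ) ^ (2 * β) ≤ 2 ^ (2:ℝ) := Real.rpow_le_rpow_of_exponent_le (by norm_num) (by linarith)
      _ = 4 := by norm_num
  have e3 : ((n:ℝ) + 2) ^ (-(2 - 2 * β)) = (1 / ((n:ℝ) + 2)) ^ 2 * ((n:ℝ) + 2) ^ (2 * β) := by
    rw [neg_sub, Real.rpow_sub hpos]
    norm_num
    field_simp
  rw [e1, e3]
  have : 0 ≤ (1 / ((n:ℝ) + 2)) ^ 2 * ((n:ℝ) + 2) ^ (2 * β) := by positivity
  nlinarith

lemma polar (N : ℕ) (hN : 3 ≤ N) (f : EN N → ENNReal) (hf : Measurable f) :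
    ∫⁻ y, f y = ∫⁻ θ : sphere (0 : EN N) 1, (∫⁻ r in Ioi (0:ℝ), ENNReal.ofReal (r ^ (N - 1)) *
      f (r • (θ : EN N))) ∂((volume : Measure (EN N)).toSphere) := by
  have : Nonempty (Fin N) := ⟨⟨0, by omega⟩⟩
  have : Nontrivial (EN N) := inferInstance
  have hdim : Module.finrank ℝ (EN N) = N := by simp
  have h1 : ∫⁻ y, f y = ∫⁻ y in ({0}ᶜ : Set (EN N)), f y := by
    rw [MeasureTheory.restrict_compl_singleton]
  have h2 : ∫⁻ y in ({0}ᶜ : Set (EN N)), f y =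
      ∫⁻ y : ({0}ᶜ : Set (EN N)), f y ∂(volume.comap Subtype.val) := by
    rw [← lintegral_subtype_comap (measurableSet_singleton _).compl]
  have mp := (volume : Measure (EN N)).measurePreserving_homeomorphUnitSphereProd
  rw [h1, h2]
  have h3 : (fun y : ({0}ᶜ : Set (EN N)) => f y) =
      (fun p : sphere (0 : EN N) 1 × Ioi (0:ℝ) => f (p.2.1 • (p.1 : EN N))) ∘
        (homeomorphUnitSphereProd (EN N)) := by
    funext y
    simp only [Function.comp]
    congr 1
    have := (homeomorphUnitSphereProd (EN N)).symm_apply_apply y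
    conv_lhs => rw [← this]
    rfl
  rw [h3]
  have hm : Measurable (fun p : sphere (0 : EN N) 1 × Ioi (0:ℝ) => f (p.2.1 • (p.1 : EN N))) := by
    apply hf.comp
    have : Continuous (fun p : sphere (0 : EN N) 1 × Ioi (0:ℝ) => p.2.1 • (p.1 : EN N)) := by
      fun_prop
    exact this.measurable
  have h4 := mp.lintegral_comp hm
  refine h4.trans ?_
  rw [lintegral_prod _ hm.aemeasurable]
  congr 1
  funext θ
  have hg : Measurable (fun r : Ioi (0:ℝ) => f (r.1 • (θ : EN N))) :=
    hm.comp (measurable_const.prodMk measurable_id)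
  have h5 := lintegral_withDensity_eq_lintegral_mul (Measure.comap Subtype.val volume)
    (f := fun r : Ioi (0:ℝ) => ENNReal.ofReal (r.1 ^ (Module.finrank ℝ (EN N) - 1)))
    (by fun_prop) hg
  rw [Measure.volumeIoiPow]
  refine h5.trans ?_
  rw [hdim, ← lintegral_subtype_comap measurableSet_Ioi]
  rfl

/-- radial version with an upper bound on each ray -/
lemma polar_le (N : ℕ) (hN : 3 ≤ N) (f : EN N → ENNReal) (hf : Measurable f) (C : ENNReal)
    (h : ∀ θ : EN N, ‖θ‖ = 1 → (∫⁻ r in Ioi (0:ℝ), ENNReal.ofReal (r ^ (N - 1)) * f (r • θ)) ≤ C) :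
    ∫⁻ y, f y ≤ C * (volume : Measure (EN N)).toSphere univ := by
  rw [polar N hN f hf]
  calc _ ≤ ∫⁻ θ : sphere (0 : EN N) 1, C ∂((volume : Measure (EN N)).toSphere) := by
        apply lintegral_mono
        intro θ
        exact h θ (by simp)
    _ = _ := by rw [lintegral_const]

lemma lint_scale (c : ℝ) (hc : 0 < c) (f : ℝ → ENNReal) :
    ∫⁻ r in Ioi (0:ℝ), ENNReal.ofReal c * f (c * r) = ∫⁻ a in Ioi (0:ℝ), f a := by
  have him : (fun r => c * r) '' (Ioi (0:ℝ)) = Ioi 0 := by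
    simp [image_mul_left_Ioi hc]
  have := lintegral_image_eq_lintegral_abs_deriv_mul (s := Ioi (0:ℝ)) measurableSet_Ioi
    (f := fun r => c * r) (f' := fun _ => c)
    (fun x _ => by simpa using ((hasDerivAt_id x).const_mul c).hasDerivWithinAt)
    (fun x _ y _ h => mul_left_cancel₀ hc.ne' h) f
  rw [him, abs_of_pos hc] at this
  exact this.symm

/-- kernel weight -/
def kw (N : ℕ) (α : ℝ) (y : EN N) : ℝ := ‖y‖ ^ (-((N : ℝ) + α))

lemma kw_meas (N : ℕ) (α : ℝ) : Measurable (kw N α) := by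
  unfold kw; exact measurable_norm.pow_const _

lemma kw_nonneg (N : ℕ) (α : ℝ) (y : EN N) : 0 ≤ kw N α y := Real.rpow_nonneg (norm_nonneg _) _

lemma pow_mul_kw (N : ℕ) (hN : 3 ≤ N) (α r : ℝ) (hr : 0 < r) (θ : EN N) (hθ : ‖θ‖ = 1) :
    r ^ (N - 1) * kw N α (r • θ) = r ^ (-1 - α) := by
  unfold kw
  rw [norm_smul, hθ, mul_one, Real.norm_eq_abs, abs_of_pos hr, ← Real.rpow_natCast,
    ← Real.rpow_add hr, Nat.cast_sub (by omega)]
  congr 1; push_cast; ring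

/-- For functions of a linear form, reduction of a ray integral. -/
lemma ray_scale (N : ℕ) (hN : 3 ≤ N) (β : ℝ) (hβ : 0 < β) (F : ℝ → ℝ) (hF : ∀ a, F |a| = F a)
    (hF0 : F 0 = 0) (b θ : EN N) (hθ : ‖θ‖ = 1) :
    ∫⁻ r in Ioi (0:ℝ), ENNReal.ofReal (r ^ (N - 1)) *
      ENNReal.ofReal (F (inner ℝ b (r • θ)) * kw N (2 * β) (r • θ)) =
    ENNReal.ofReal (|inner ℝ b θ| ^ (2 * β)) *
      ∫⁻ a in Ioi (0:ℝ), ENNReal.ofReal (F a * a ^ (-1 - 2 * β)) := by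
  set c := |(inner ℝ b θ : ℝ)| with hc
  have h1 : ∫⁻ r in Ioi (0:ℝ), ENNReal.ofReal (r ^ (N - 1)) *
      ENNReal.ofReal (F (inner ℝ b (r • θ)) * kw N (2 * β) (r • θ)) =
      ∫⁻ r in Ioi (0:ℝ), ENNReal.ofReal (F (c * r) * r ^ (-1 - 2 * β)) := by
    apply setLIntegral_congr_fun measurableSet_Ioi
    intro r hr
    have hr0 : 0 < r := hr
    simp only
    rw [← ENNReal.ofReal_mul (by positivity)]
    congr 1
    rw [← pow_mul_kw N hN (2 * β) r hr0 θ hθ, inner_smul_right, ← hF (r * inner ℝ b θ), abs_mul,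
      abs_of_pos hr0, mul_comm r]
    ring
  rw [h1]
  rcases (abs_nonneg (inner ℝ b θ : ℝ)).eq_or_lt with h0 | h0
  · rw [← hc] at h0
    rw [← h0]
    simp [hF0, Real.zero_rpow (by positivity : 2 * β ≠ 0)]
  · rw [← hc] at h0
    rw [← lint_scale c h0 (fun a => ENNReal.ofReal (F a * a ^ (-1 - 2 * β))),
      ← lintegral_const_mul' _ _ ENNReal.ofReal_ne_top]
    apply setLIntegral_congr_fun measurableSet_Ioi
    intro r hr
    have hr0 : 0 < r := hr
    simp only
    rw [← ENNReal.ofReal_mul (by positivity), ← ENNReal.ofReal_mul (by positivity)]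
    congr 1
    rw [Real.mul_rpow h0.le hr0.le]
    have : c ^ (2 * β) * (c * c ^ (-1 - 2 * β)) = 1 := by
      nth_rewrite 2 [← Real.rpow_one c]
      rw [← Real.rpow_add h0, ← Real.rpow_add h0]
      rw [show 2 * β + (1 + (-1 - 2 * β)) = 0 by ring, Real.rpow_zero]
    linear_combination (-(F (c * r) * r ^ (-1 - 2 * β))) * this

def Sneg (β : ℝ) : ENNReal := ∫⁻ a in Ioi (0:ℝ), ENNReal.ofReal (-(Sf β a) * a ^ (-1 - 2 * β))

lemma Sneg_lt (β : ℝ) (hβ : 0 < β) (hβ1 : β < 1) : Sneg β < ⊤ := by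
  have h := (Sk_integrable β hβ hβ1).neg
  have := h.lintegral_lt_top
  unfold Sneg
  simpa [neg_mul] using this

lemma Spos_le (β : ℝ) (hβ : 0 < β) (hβ1 : β < 1) :
    ∫⁻ a in Ioi (0:ℝ), ENNReal.ofReal (Sf β a * a ^ (-1 - 2 * β)) ≤ Sneg β := by
  have h := Sk_integrable β hβ hβ1
  have h0 := Sk_integral_nonpos β hβ hβ1
  rw [integral_eq_lintegral_pos_part_sub_lintegral_neg_part h] at h0
  have hn := Sneg_lt β hβ hβ1
  unfold Sneg at *
  simp only [neg_mul] at *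
  exact (ENNReal.toReal_le_toReal h.lintegral_lt_top.ne hn.ne).1 (by linarith)

lemma Sb_le (N : ℕ) (hN : 3 ≤ N) (β : ℝ) (hβ : 0 < β) (hβ1 : β < 1) (b : EN N) :
    ∫⁻ y, ENNReal.ofReal (Sf β (inner ℝ b y) * kw N (2 * β) y) ≤
    ∫⁻ y, ENNReal.ofReal (-(Sf β (inner ℝ b y)) * kw N (2 * β) y) := by
  have hm := (Sf_cont β hβ).measurable
  have hk := kw_meas N (2 * β)
  have hi : Measurable fun y : EN N => (inner ℝ b y : ℝ) := by fun_prop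
  rw [polar N hN (fun y => ENNReal.ofReal (Sf β (inner ℝ b y) * kw N (2 * β) y))
      (((hm.comp hi).mul hk).ennreal_ofReal),
    polar N hN (fun y => ENNReal.ofReal (-(Sf β (inner ℝ b y)) * kw N (2 * β) y))
      (((hm.comp hi).neg.mul hk).ennreal_ofReal)]
  apply lintegral_mono
  intro θ
  have hθ : ‖(θ : EN N)‖ = 1 := by simp
  have e1 := ray_scale N hN β hβ (Sf β) (Sf_abs β) (Sf_zero β) b θ hθ
  have e2 := ray_scale N hN β hβ (fun a => -(Sf β a)) (fun a => by rw [Sf_abs β])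
    (by rw [Sf_zero β, neg_zero]) b θ hθ
  simp only at e1 e2 ⊢
  rw [e1, e2]
  exact mul_le_mul' le_rfl (Spos_le β hβ hβ1)

lemma Sb_neg_le (N : ℕ) (hN : 3 ≤ N) (β : ℝ) (hβ : 0 < β) (b : EN N) :
    ∫⁻ y, ENNReal.ofReal (-(Sf β (inner ℝ b y)) * kw N (2 * β) y) ≤
    ENNReal.ofReal (‖b‖ ^ (2 * β)) * Sneg β * (volume : Measure (EN N)).toSphere univ := by
  have hm := (Sf_cont β hβ).measurable
  have hk := kw_meas N (2 * β)
  have hi : Measurable fun y : EN N => (inner ℝ b y : ℝ) := by fun_prop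
  apply polar_le N hN (fun y => ENNReal.ofReal (-(Sf β (inner ℝ b y)) * kw N (2 * β) y))
    (((hm.comp hi).neg.mul hk).ennreal_ofReal)
  intro θ hθ
  have e2 := ray_scale N hN β hβ (fun a => -(Sf β a)) (fun a => by rw [Sf_abs β])
    (by rw [Sf_zero β, neg_zero]) b θ hθ
  rw [e2]
  unfold Sneg
  gcongr
  have := abs_real_inner_le_norm b θ
  rwa [hθ, mul_one] at this

/-- tail integral -/
lemma tail_int (β h : ℝ) (hβ : 0 < β) (hh : 0 < h) :
    ∫⁻ r in Ioi h, ENNReal.ofReal (r ^ (-1 - β)) = ENNReal.ofReal (h ^ (-β) / β) := by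
  rw [← ofReal_integral_eq_lintegral_ofReal (integrableOn_Ioi_rpow_of_lt (by linarith) hh)]
  · rw [integral_Ioi_rpow_of_lt (by linarith) hh]
    congr 1
    rw [show -1 - β + 1 = -β by ring]; field_simp
  · filter_upwards [ae_restrict_mem measurableSet_Ioi] with r hr
    exact Real.rpow_nonneg (hh.trans hr).le _

lemma tail_kw (N : ℕ) (hN : 3 ≤ N) (α h : ℝ) (hα : 0 < α) (hh : 0 < h) :
    ∫⁻ y in {y : EN N | h < ‖y‖}, ENNReal.ofReal (kw N α y) < ⊤ := by
  have hS : MeasurableSet {y : EN N | h < ‖y‖} := measurableSet_lt measurable_const measurable_norm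
  rw [← lintegral_indicator hS]
  refine lt_of_le_of_lt (polar_le N hN _ ((kw_meas N α).ennreal_ofReal.indicator hS)
    (ENNReal.ofReal (h ^ (-α) / α)) ?_) ?_
  · intro θ hθ
    rw [← tail_int α h hα hh, ← lintegral_indicator measurableSet_Ioi, ← lintegral_indicator measurableSet_Ioi]
    apply lintegral_mono
    intro r
    by_cases h1 : h < r
    · have hr : 0 < r := hh.trans h1
      have : r • θ ∈ {y : EN N | h < ‖y‖} := by
        simp [norm_smul, hθ, abs_of_pos hr, h1]
      simp only [indicator_of_mem (mem_Ioi.2 hr), indicator_of_mem (mem_Ioi.2 h1), indicator_of_mem this]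
      rw [← ENNReal.ofReal_mul (by positivity), pow_mul_kw N hN α r hr θ hθ]
    · by_cases hr : 0 < r
      · have : r • θ ∉ {y : EN N | h < ‖y‖} := by
          simpa [norm_smul, hθ, abs_of_pos hr] using h1
        simp only [indicator_of_mem (mem_Ioi.2 hr), indicator_of_notMem this]
        simp
      · simp [hr]
  · exact ENNReal.mul_lt_top ENNReal.ofReal_lt_top (measure_lt_top _ _)

/-- truncated profile -/
def ph {N : ℕ} (β s : ℝ) (x : EN N) : ℝ := max (s - ‖x‖ ^ 2) 0 ^ β

lemma ph_nonneg {N : ℕ} (β s : ℝ) (x : EN N) : 0 ≤ ph β s x :=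
  Real.rpow_nonneg (le_max_right _ _) _

lemma ph_eq_zero {N : ℕ} (β s : ℝ) (hβ : 0 < β) (x : EN N) (h : s ≤ ‖x‖ ^ 2) : ph β s x = 0 := by
  unfold ph; rw [max_eq_right (by linarith), Real.zero_rpow hβ.ne']

lemma ph_le_one {N : ℕ} (β s : ℝ) (hβ : 0 < β) (hs : s ≤ 1) (x : EN N) : ph β s x ≤ 1 :=
  Real.rpow_le_one (le_max_right _ _) (by
    apply max_le _ zero_le_one
    nlinarith [sq_nonneg ‖x‖]) hβ.le

lemma ph_meas {N : ℕ} (β : ℝ) : Measurable fun p : ℝ × EN N => ph β p.1 p.2 := by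
  unfold ph
  exact Measurable.pow_const (by fun_prop) _

lemma ph_tail (N : ℕ) (hN : 3 ≤ N) (β s : ℝ) (hβ : 0 < β) (hβ1 : β < 1) (hs : 0 < s) (hs1 : s < 1)
    (x : EN N) (hx : s < ‖x‖ ^ 2) (w : EN N → EN N) (hw : Measurable w) (hwx : ∀ y, ‖w y - x‖ = ‖y‖) :
    ∫⁻ y, ENNReal.ofReal (ph β s (w y) * kw N (2 * β) y) ≤
      ENNReal.ofReal (2 / β) * (volume : Measure (EN N)).toSphere univ *
        ENNReal.ofReal ((‖x‖ - √s) ^ (-β)) := by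
  have hss : √s ^ 2 = s := Real.sq_sqrt hs.le
  have hs0 : 0 < √s := Real.sqrt_pos.2 hs
  have hs2 : √s < 1 := by nlinarith
  set h := ‖x‖ - √s with hh
  have hh0 : 0 < h := by nlinarith [norm_nonneg x]
  have hpt : ∀ y, ph β s (w y) ≤ if h < ‖y‖ then 2 * ‖y‖ ^ β else 0 := by
    intro y
    have h1 : ‖x‖ ≤ ‖w y‖ + ‖y‖ := by
      have := norm_sub_norm_le x (w y)
      rw [norm_sub_rev, hwx] at this; linarith
    split_ifs with hy
    · unfold ph
      have h2 : max (s - ‖w y‖ ^ 2) 0 ≤ 2 * ‖y‖ := by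
        apply max_le _ (by positivity)
        by_cases h3 : ‖w y‖ ≤ √s
        · nlinarith [norm_nonneg (w y), norm_nonneg y]
        · push Not at h3
          nlinarith [norm_nonneg (w y), norm_nonneg y]
      calc _ ≤ (2 * ‖y‖) ^ β := Real.rpow_le_rpow (le_max_right _ _) h2 hβ.le
        _ = 2 ^ β * ‖y‖ ^ β := Real.mul_rpow (by norm_num) (norm_nonneg _)
        _ ≤ 2 * ‖y‖ ^ β := by
          gcongr
          calc (2:ℝ) ^ β ≤ 2 ^ (1:ℝ) := Real.rpow_le_rpow_of_exponent_le (by norm_num) hβ1.le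
            _ = 2 := by norm_num
    · push Not at hy
      rw [ph_eq_zero β s hβ]
      have : √s ≤ ‖w y‖ := by linarith
      nlinarith
  calc _ ≤ ∫⁻ y : EN N, ENNReal.ofReal ((if h < ‖y‖ then 2 * ‖y‖ ^ β else 0) * kw N (2 * β) y) := by
        apply lintegral_mono
        intro y
        apply ENNReal.ofReal_le_ofReal
        gcongr
        · exact kw_nonneg _ _ _
        · exact hpt y
    _ ≤ ENNReal.ofReal (2 * (h ^ (-β) / β)) * (volume : Measure (EN N)).toSphere univ := by
        apply polar_le N hN
        · refine Measurable.ennreal_ofReal (Measurable.mul ?_ (kw_meas _ _))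
          exact Measurable.ite (measurableSet_lt measurable_const measurable_norm)
            (measurable_const.mul (measurable_norm.pow_const _)) measurable_const
        · intro θ hθ
          rw [ENNReal.ofReal_mul (by norm_num), ← tail_int β h hβ hh0,
            ← lintegral_indicator measurableSet_Ioi, ← lintegral_indicator measurableSet_Ioi,
            ← lintegral_const_mul' _ _ ENNReal.ofReal_ne_top]
          apply lintegral_mono
          intro r
          by_cases hr : 0 < r
          · have hn : ‖r • θ‖ = r := by rw [norm_smul, hθ, mul_one, Real.norm_eq_abs, abs_of_pos hr]
            simp only [indicator_of_mem (mem_Ioi.2 hr), hn]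
            by_cases h1 : h < r
            · simp only [indicator_of_mem (mem_Ioi.2 h1), if_pos h1]
              rw [← ENNReal.ofReal_mul (by positivity), ← ENNReal.ofReal_mul (by positivity)]
              apply le_of_eq; congr 1
              have := pow_mul_kw N hN (2 * β) r hr θ hθ
              have e : r ^ (-1 - β) = r ^ β * r ^ (-1 - 2 * β) := by
                rw [← Real.rpow_add hr]; congr 1; ring
              rw [e, ← this]; ring
            · simp [h1]
          · simp [hr]
    _ = _ := by
        rw [mul_right_comm, ← ENNReal.ofReal_mul (by positivity)]
        congr 2; ring

lemma int_of_parts {X : Type*} [MeasurableSpace X] (P : Measure X) (f : X → ℝ) (hf : Measurable f)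
    (hle : ∫⁻ x, ENNReal.ofReal (f x) ∂P ≤ ∫⁻ x, ENNReal.ofReal (-f x) ∂P)
    (hlt : ∫⁻ x, ENNReal.ofReal (-f x) ∂P < ⊤) : Integrable f P ∧ ∫ x, f x ∂P ≤ 0 := by
  have hi : Integrable f P := by
    refine ⟨hf.aestronglyMeasurable, ?_⟩
    rw [hasFiniteIntegral_iff_norm]
    calc ∫⁻ x, ENNReal.ofReal ‖f x‖ ∂P
        ≤ ∫⁻ x, (ENNReal.ofReal (f x) + ENNReal.ofReal (-f x)) ∂P := by
          apply lintegral_mono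
          intro x
          rcases le_total 0 (f x) with h | h
          · simp [Real.norm_eq_abs, abs_of_nonneg h]
          · simp [Real.norm_eq_abs, abs_of_nonpos h]
      _ = _ := lintegral_add_left hf.ennreal_ofReal _
      _ < ⊤ := ENNReal.add_lt_top.2 ⟨hle.trans_lt hlt, hlt⟩
  refine ⟨hi, ?_⟩
  rw [integral_eq_lintegral_pos_part_sub_lintegral_neg_part hi]
  have := ENNReal.toReal_mono hlt.ne hle
  linarith

/-- weighted measure -/
def nu (N : ℕ) (β : ℝ) : Measure (EN N) := volume.withDensity fun y => ENNReal.ofReal (kw N (2 * β) y)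

instance (N : ℕ) (β : ℝ) : SFinite (nu N β) := by unfold nu; infer_instance

lemma nu_lint (N : ℕ) (β : ℝ) (F : EN N → ℝ) (hF : Measurable F) :
    ∫⁻ y, ENNReal.ofReal (F y) ∂(nu N β) = ∫⁻ y, ENNReal.ofReal (F y * kw N (2 * β) y) := by
  unfold nu
  rw [lintegral_withDensity_eq_lintegral_mul _ (kw_meas _ _).ennreal_ofReal hF.ennreal_ofReal]
  apply lintegral_congr
  intro y
  simp only [Pi.mul_apply]
  rw [mul_comm, ENNReal.ofReal_mul' (kw_nonneg _ _ _)]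

def An (N : ℕ) (η : ℝ) : Set (EN N) := {y | η < ‖y‖}

lemma An_meas (N : ℕ) (η : ℝ) : MeasurableSet (An N η) :=
  measurableSet_lt measurable_const measurable_norm

lemma nu_An (N : ℕ) (hN : 3 ≤ N) (β η : ℝ) (hβ : 0 < β) (hη : 0 < η) : nu N β (An N η) < ⊤ := by
  unfold nu
  rw [withDensity_apply _ (An_meas N η)]
  exact tail_kw N hN (2 * β) η (by positivity) hη

lemma nu_zero (N : ℕ) (hN : 3 ≤ N) (β : ℝ) : nu N β {0} = 0 := by
  have : Nonempty (Fin N) := ⟨⟨0, by omega⟩⟩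
  have : Nontrivial (EN N) := inferInstance
  exact (withDensity_absolutelyContinuous _ _) (measure_singleton 0)

/-- symmetrization of the truncated integral -/
lemma sym_trunc (N : ℕ) (hN : 3 ≤ N) (β η : ℝ) (hβ : 0 < β) (hη : 0 < η) (f : EN N → ℝ)
    (hf : Measurable f) (C : ℝ) (hC : ∀ y, |f y| ≤ C) (x : EN N) :
    2 * ∫ y in {y : EN N | η < dist y x}, (f y - f x) / dist y x ^ ((N : ℝ) + 2 * β) =
      ∫ y in An N η, (f (x + y) + f (x - y) - 2 * f x) ∂(nu N β) := by
  set G : EN N → ℝ := fun z => (An N η).indicator (fun w => (f (x + w) - f x) * kw N (2 * β) w) (z - x)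
  have hk : ∀ F : EN N → ℝ, ∫ y in An N η, F y ∂(nu N β) =
      ∫ y, (An N η).indicator (fun w => F w * kw N (2 * β) w) y := by
    intro F
    unfold nu
    rw [setIntegral_withDensity_eq_setIntegral_toReal_smul (kw_meas _ _).ennreal_ofReal
      (by simp) _ (An_meas N η), integral_indicator (An_meas N η)]
    congr 1
    funext y
    rw [ENNReal.toReal_ofReal (kw_nonneg _ _ _), smul_eq_mul, mul_comm]
  have h0 : ∫ y in {y : EN N | η < dist y x}, (f y - f x) / dist y x ^ ((N : ℝ) + 2 * β) = ∫ z, G z := by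
    have hm : MeasurableSet {y : EN N | η < dist y x} :=
      measurableSet_lt measurable_const (by fun_prop)
    rw [← integral_indicator hm]
    congr 1
    funext z
    by_cases hz : η < dist z x
    · have h1 : z - x ∈ An N η := by simpa [An, ← dist_eq_norm] using hz
      have h2 : z ∈ {y : EN N | η < dist y x} := hz
      simp only [G, indicator_of_mem h1, indicator_of_mem h2, kw, add_sub_cancel]
      rw [Real.rpow_neg (norm_nonneg _), dist_eq_norm, div_eq_mul_inv]
    · have h1 : z - x ∉ An N η := by simpa [An, ← dist_eq_norm] using hz
      have h2 : z ∉ {y : EN N | η < dist y x} := hz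
      simp only [G, indicator_of_notMem h1, indicator_of_notMem h2]
  have h1 : ∫ y in An N η, (f (x + y) - f x) ∂(nu N β) = ∫ z, G z := by
    rw [hk, ← integral_add_left_eq_self G x]
    congr 1; funext y
    simp [G]
  have h2 : ∫ y in An N η, (f (x - y) - f x) ∂(nu N β) = ∫ z, G z := by
    rw [hk, ← integral_sub_left_eq_self G volume x]
    congr 1; funext y
    simp only [G, sub_sub_cancel_left, indicator, An, mem_setOf_eq, norm_neg, kw, ← sub_eq_add_neg]
  have hfin : IsFiniteMeasure ((nu N β).restrict (An N η)) :=
    ⟨by simpa using nu_An N hN β η hβ hη⟩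
  have i1 : Integrable (fun y => f (x + y) - f x) ((nu N β).restrict (An N η)) := by
    apply Integrable.of_bound (C := 2 * C) (Measurable.aestronglyMeasurable (by fun_prop))
    refine Eventually.of_forall fun y => ?_
    have := abs_sub (f (x + y)) (f x)
    rw [Real.norm_eq_abs]; linarith [hC (x + y), hC x]
  have i2 : Integrable (fun y => f (x - y) - f x) ((nu N β).restrict (An N η)) := by
    apply Integrable.of_bound (C := 2 * C) (Measurable.aestronglyMeasurable (by fun_prop))
    refine Eventually.of_forall fun y => ?_
    have := abs_sub (f (x - y)) (f x)
    rw [Real.norm_eq_abs]; linarith [hC (x - y), hC x]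
  rw [h0, two_mul]
  nth_rewrite 1 [← h1]
  rw [← h2, ← integral_add i1 i2]
  congr 1; funext y; ring

/-- interior part -/
def E1 {N : ℕ} (β : ℝ) (x : EN N) (p : ℝ × EN N) : ℝ :=
  if ‖x‖ ^ 2 < p.1 then (p.1 - ‖x‖ ^ 2) ^ β * Sf β (inner ℝ ((2 / (p.1 - ‖x‖ ^ 2)) • x) p.2) else 0

/-- exterior part -/
def E2 {N : ℕ} (β : ℝ) (x : EN N) (p : ℝ × EN N) : ℝ :=
  if ‖x‖ ^ 2 < p.1 then 0 else ph β p.1 (x + p.2) + ph β p.1 (x - p.2)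

def Dd {N : ℕ} (β : ℝ) (x : EN N) (p : ℝ × EN N) : ℝ :=
  ph β p.1 (x + p.2) + ph β p.1 (x - p.2) - 2 * ph β p.1 x

lemma Dd_le {N : ℕ} (β : ℝ) (hβ : 0 < β) (x : EN N) (p : ℝ × EN N) :
    Dd β x p ≤ E1 β x p + E2 β x p := by
  obtain ⟨s, y⟩ := p
  unfold Dd E1 E2
  simp only
  split_ifs with h
  · set d := s - ‖x‖ ^ 2 with hd
    have hd0 : 0 < d := by linarith
    have e : inner ℝ ((2 / d) • x) y = 2 * inner ℝ x y / d := by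
      rw [inner_smul_left]; simp; ring
    have h1 : ‖x + y‖ ^ 2 = ‖x‖ ^ 2 + 2 * inner ℝ x y + ‖y‖ ^ 2 := norm_add_sq_real x y
    have h2 : ‖x - y‖ ^ 2 = ‖x‖ ^ 2 - 2 * inner ℝ x y + ‖y‖ ^ 2 := norm_sub_sq_real x y
    rw [e]
    have key : ∀ w : EN N, ∀ a : ℝ, s - ‖w‖ ^ 2 ≤ d * (1 + a) → ph β s w ≤ d ^ β * max (1 + a) 0 ^ β := by
      intro w a hw
      unfold ph
      rw [← Real.mul_rpow hd0.le (le_max_right _ _)]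
      apply Real.rpow_le_rpow (le_max_right _ _) _ hβ.le
      apply max_le
      · exact hw.trans (mul_le_mul_of_nonneg_left (le_max_left _ _) hd0.le)
      · exact mul_nonneg hd0.le (le_max_right _ _)
    have hp := key (x - y) (2 * inner ℝ x y / d) (by
      rw [mul_add, mul_div_cancel₀ _ hd0.ne']; nlinarith [sq_nonneg ‖y‖])
    have hm := key (x + y) (-(2 * inner ℝ x y / d)) (by
      rw [mul_add, mul_neg, mul_div_cancel₀ _ hd0.ne']; nlinarith [sq_nonneg ‖y‖])
    have hx : ph β s x = d ^ β := by
      unfold ph; rw [max_eq_left (by linarith)]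
    unfold Sf
    rw [hx]
    rw [← sub_eq_add_neg] at hm
    nlinarith
  · rw [ph_eq_zero β s hβ x (by linarith)]
    simp

lemma E2_nonneg {N : ℕ} (β : ℝ) (x : EN N) (p : ℝ × EN N) : 0 ≤ E2 β x p := by
  unfold E2; split_ifs
  · exact le_rfl
  · exact add_nonneg (ph_nonneg _ _ _) (ph_nonneg _ _ _)

lemma ph_comp {N : ℕ} {X : Type*} [MeasurableSpace X] (β : ℝ) (a : X → ℝ) (w : X → EN N)
    (ha : Measurable a) (hw : Measurable w) : Measurable fun q => ph β (a q) (w q) := by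
  unfold ph
  exact Measurable.pow_const (by fun_prop) _

lemma Dd_meas {N : ℕ} (β : ℝ) (x : EN N) : Measurable (Dd β x) := by
  unfold Dd
  exact ((ph_comp β _ _ measurable_fst (by fun_prop)).add
    (ph_comp β _ _ measurable_fst (by fun_prop))).sub
    ((ph_comp β _ _ measurable_fst measurable_const).const_mul 2)

lemma E2_meas3 {N : ℕ} (β : ℝ) : Measurable (fun q : EN N × (ℝ × EN N) => E2 β q.1 q.2) := by
  unfold E2
  exact Measurable.ite (measurableSet_lt (by fun_prop) (by fun_prop)) measurable_const
    ((ph_comp β _ _ (by fun_prop) (by fun_prop)).add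
    (ph_comp β _ _ (by fun_prop) (by fun_prop)))

lemma E2_meas {N : ℕ} (β : ℝ) (x : EN N) : Measurable (E2 β x) := by
  unfold E2
  exact Measurable.ite (measurableSet_lt (by fun_prop) (by fun_prop)) measurable_const
    ((ph_comp β _ _ (by fun_prop) (by fun_prop)).add
    (ph_comp β _ _ (by fun_prop) (by fun_prop)))

lemma E1_meas {N : ℕ} (β : ℝ) (hβ : 0 < β) (x : EN N) : Measurable (E1 β x) := by
  unfold E1
  refine Measurable.ite (measurableSet_lt measurable_const measurable_fst) ?_ measurable_const
  apply Measurable.mul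
  · exact Measurable.pow_const (by fun_prop) _
  · apply (Sf_cont β hβ).measurable.comp
    fun_prop

lemma rpow_lint (β : ℝ) (hβ : 0 < β) (hβ1 : β < 1) (t : ℝ) :
    ∫⁻ s in Ioo t 1, ENNReal.ofReal ((s - t) ^ (-β)) < ⊤ := by
  rcases le_or_gt 1 t with h | h
  · simp [Ioo_eq_empty (not_lt.2 h)]
  have h1 : IntervalIntegrable (fun s : ℝ => s ^ (-β)) volume 0 (1 - t) :=
    intervalIntegral.intervalIntegrable_rpow' (by linarith)
  have h2 := h1.comp_sub_right t
  simp only [zero_add, sub_add_cancel] at h2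
  rw [intervalIntegrable_iff_integrableOn_Ioo_of_le h.le] at h2
  exact h2.lintegral_lt_top

lemma E1_int (N : ℕ) (hN : 3 ≤ N) (β : ℝ) (hβ : 0 < β) (hβ1 : β < 1) (μ : Measure ℝ)
    [IsProbabilityMeasure μ] (M : ENNReal) (hM : M ≠ ⊤) (hμM : μ ≤ M • volume)
    (hμ : ∀ᵐ s ∂μ, 0 < s ∧ s < 1) (x : EN N) :
    Integrable (E1 β x) (μ.prod (nu N β)) ∧ ∫ p, E1 β x p ∂(μ.prod (nu N β)) ≤ 0 := by
  have hm := E1_meas β hβ x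
  have hS := (Sf_cont β hβ).measurable
  have hmn : Measurable fun p => -E1 β x p := hm.neg
  have hin : ∀ s : ℝ, ‖x‖ ^ 2 < s → ∀ σ : ℝ, ∫⁻ y, ENNReal.ofReal (σ * E1 β x (s, y)) ∂(nu N β) =
      ENNReal.ofReal ((s - ‖x‖ ^ 2) ^ β) * ∫⁻ y, ENNReal.ofReal
        (σ * Sf β (inner ℝ ((2 / (s - ‖x‖ ^ 2)) • x) y) * kw N (2 * β) y) := by
    intro s hs σ
    have h0 : 0 ≤ (s - ‖x‖ ^ 2) ^ β := Real.rpow_nonneg (by linarith) _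
    rw [← nu_lint N β (fun y => σ * Sf β (inner ℝ ((2 / (s - ‖x‖ ^ 2)) • x) y))
      ((hS.comp (by fun_prop)).const_mul σ), ← lintegral_const_mul' _ _ ENNReal.ofReal_ne_top]
    apply lintegral_congr
    intro y
    rw [← ENNReal.ofReal_mul h0]
    congr 1
    simp only [E1, if_pos hs]
    ring
  have hout : ∀ s : ℝ, ¬ ‖x‖ ^ 2 < s → ∀ y, E1 β x (s, y) = 0 := by
    intro s hs y
    simp only [E1, if_neg hs]
  apply int_of_parts _ _ hm
  · rw [lintegral_prod _ hm.ennreal_ofReal.aemeasurable,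
      lintegral_prod _ hmn.ennreal_ofReal.aemeasurable]
    apply lintegral_mono
    intro s
    by_cases hs : ‖x‖ ^ 2 < s
    · have a1 := hin s hs 1
      have a2 := hin s hs (-1)
      simp only [one_mul, neg_mul] at a1 a2
      simp only
      rw [a1, a2]
      refine mul_le_mul' le_rfl ?_
      have := Sb_le N hN β hβ hβ1 ((2 / (s - ‖x‖ ^ 2)) • x)
      simpa only [neg_mul] using this
    · simp [hout s hs]
  · rw [lintegral_prod _ hmn.ennreal_ofReal.aemeasurable]
    set K := ENNReal.ofReal ((2 * ‖x‖) ^ (2 * β)) * (Sneg β * (volume : Measure (EN N)).toSphere univ) with hK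
    have hKt : K < ⊤ := ENNReal.mul_lt_top ENNReal.ofReal_lt_top
      (ENNReal.mul_lt_top (Sneg_lt β hβ hβ1) (measure_lt_top _ _))
    calc _ ≤ ∫⁻ s, K * (Ioo (‖x‖ ^ 2) 1).indicator
            (fun s => ENNReal.ofReal ((s - ‖x‖ ^ 2) ^ (-β))) s ∂μ := by
          apply lintegral_mono_ae
          filter_upwards [hμ] with s hs1
          by_cases hs : ‖x‖ ^ 2 < s
          · have a2 := hin s hs (-1)
            simp only [neg_mul, one_mul] at a2
            rw [a2]
            have a3 := Sb_neg_le N hN β hβ ((2 / (s - ‖x‖ ^ 2)) • x)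
            simp only [neg_mul] at a3
            rw [indicator_of_mem (mem_Ioo.2 ⟨hs, hs1.2⟩)]
            refine (mul_le_mul' le_rfl a3).trans (le_of_eq ?_)
            have hd0 : 0 < s - ‖x‖ ^ 2 := by linarith
            rw [mul_assoc, ← mul_assoc, ← ENNReal.ofReal_mul (Real.rpow_nonneg hd0.le _), hK,
              mul_right_comm, ← ENNReal.ofReal_mul (by positivity)]
            congr 2
            rw [norm_smul, Real.norm_eq_abs, abs_of_pos (by positivity),
              show 2 / (s - ‖x‖ ^ 2) * ‖x‖ = (2 * ‖x‖) / (s - ‖x‖ ^ 2) by ring,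
              Real.div_rpow (by positivity) hd0.le, mul_div_left_comm]
            congr 1
            rw [← Real.rpow_sub hd0]; congr 1; ring
          · simp [hout s hs]
      _ ≤ ∫⁻ s, K * (Ioo (‖x‖ ^ 2) 1).indicator
            (fun s => ENNReal.ofReal ((s - ‖x‖ ^ 2) ^ (-β))) s ∂(M • volume) :=
          lintegral_mono' hμM le_rfl
      _ < ⊤ := by
          rw [lintegral_smul_measure, lintegral_const_mul' _ _ hKt.ne, lintegral_indicator measurableSet_Ioo]
          exact ENNReal.mul_lt_top hM.lt_top (ENNReal.mul_lt_top hKt (rpow_lint β hβ hβ1 _))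

/-- test function -/
def phm {N : ℕ} (β : ℝ) (μ : Measure ℝ) (x : EN N) : ℝ := ∫ s, ph β s x ∂μ

lemma phm_meas {N : ℕ} (β : ℝ) (μ : Measure ℝ) [SFinite μ] : Measurable (phm (N := N) β μ) := by
  have h : Measurable fun q : EN N × ℝ => ph β q.2 q.1 := ph_comp β _ _ (by fun_prop) (by fun_prop)
  exact (h.stronglyMeasurable.integral_prod_right').measurable

lemma ph_bd {N : ℕ} (β : ℝ) (hβ : 0 < β) (μ : Measure ℝ) (hμ : ∀ᵐ s ∂μ, 0 < s ∧ s < 1) (x : EN N) :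
    ∀ᵐ s ∂μ, ‖ph β s x‖ ≤ 1 := by
  filter_upwards [hμ] with s hs
  rw [Real.norm_eq_abs, abs_of_nonneg (ph_nonneg _ _ _)]
  exact ph_le_one β s hβ hs.2.le x

lemma ph_int {N : ℕ} (β : ℝ) (hβ : 0 < β) (μ : Measure ℝ) [IsProbabilityMeasure μ]
    (hμ : ∀ᵐ s ∂μ, 0 < s ∧ s < 1) (x : EN N) : Integrable (fun s => ph β s x) μ :=
  Integrable.of_bound (ph_comp β _ _ measurable_id measurable_const).aestronglyMeasurable 1
    (ph_bd β hβ μ hμ x)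

lemma phm_le {N : ℕ} (β : ℝ) (hβ : 0 < β) (μ : Measure ℝ) [IsProbabilityMeasure μ]
    (hμ : ∀ᵐ s ∂μ, 0 < s ∧ s < 1) (x : EN N) : |phm β μ x| ≤ 1 := by
  have := norm_integral_le_of_norm_le_const (ph_bd β hβ μ hμ x)
  simpa [phm] using this

lemma phm_D {N : ℕ} (β : ℝ) (hβ : 0 < β) (μ : Measure ℝ) [IsProbabilityMeasure μ]
    (hμ : ∀ᵐ s ∂μ, 0 < s ∧ s < 1) (x y : EN N) :
    ∫ s, Dd β x (s, y) ∂μ = phm β μ (x + y) + phm β μ (x - y) - 2 * phm β μ x := by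
  have a1 := ph_int β hβ μ hμ (x + y)
  have a2 := ph_int β hβ μ hμ (x - y)
  have a3 := ph_int β hβ μ hμ x
  have e1 := integral_sub (a1.add a2) (a3.const_mul 2)
  have e2 := integral_add a1 a2
  rw [integral_const_mul] at e1
  unfold phm
  rw [← e2]
  exact e1

lemma trunc_le (N : ℕ) (hN : 3 ≤ N) (β : ℝ) (hβ : 0 < β) (μ : Measure ℝ)
    [IsProbabilityMeasure μ] (hμ : ∀ᵐ s ∂μ, 0 < s ∧ s < 1) (x : EN N) (η : ℝ) (hη : 0 < η)
    (hE : Integrable (fun p => E1 β x p + E2 β x p) (μ.prod (nu N β))) :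
    2 * ∫ y in {y : EN N | η < dist y x},
      (phm β μ y - phm β μ x) / dist y x ^ ((N : ℝ) + 2 * β) ≤
    ∫ p in (univ ×ˢ An N η), (E1 β x p + E2 β x p) ∂(μ.prod (nu N β)) := by
  rw [sym_trunc N hN β η hβ hη (phm β μ) (phm_meas β μ) 1 (phm_le β hβ μ hμ) x]
  have hfin : IsFiniteMeasure ((nu N β).restrict (An N η)) :=
    ⟨by simpa using nu_An N hN β η hβ hη⟩
  have hP : (μ.prod (nu N β)).restrict (univ ×ˢ An N η) = μ.prod ((nu N β).restrict (An N η)) := by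
    rw [← Measure.prod_restrict, Measure.restrict_univ]
  have hD : Integrable (Dd β x) (μ.prod ((nu N β).restrict (An N η))) := by
    apply Integrable.of_bound (C := 4) (Dd_meas β x).aestronglyMeasurable
    have := (Measure.quasiMeasurePreserving_fst (μ := μ) (ν := (nu N β).restrict (An N η))).ae hμ
    filter_upwards [this] with p hp
    unfold Dd
    have h1 := ph_le_one β p.1 hβ hp.2.le (x + p.2)
    have h2 := ph_le_one β p.1 hβ hp.2.le (x - p.2)
    have h3 := ph_le_one β p.1 hβ hp.2.le x
    have h4 := ph_nonneg β p.1 (x + p.2)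
    have h5 := ph_nonneg β p.1 (x - p.2)
    have h6 := ph_nonneg β p.1 x
    rw [Real.norm_eq_abs, abs_le]
    constructor <;> linarith
  have h1 : ∫ y in An N η, (phm β μ (x + y) + phm β μ (x - y) - 2 * phm β μ x) ∂(nu N β) =
      ∫ p, Dd β x p ∂(μ.prod ((nu N β).restrict (An N η))) := by
    rw [integral_prod_symm _ hD]
    congr 1
    funext y
    exact (phm_D β hβ μ hμ x y).symm
  rw [h1, hP]
  apply integral_mono hD
  · rw [← hP]; exact hE.integrableOn
  · intro p; exact Dd_le β hβ x p

lemma coeff_nonneg (N : ℕ) (β : ℝ) (hβ : 0 < β) : 0 ≤ fracLapCoeff N (2 * β) := by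
  unfold fracLapCoeff
  have := Real.Gamma_nonneg_of_nonneg (s := ((N : ℝ) + 2 * β) / 2) (by positivity)
  positivity

lemma lap_bound (N : ℕ) (hN : 3 ≤ N) (β : ℝ) (hβ : 0 < β) (hβ1 : β < 1) (μ : Measure ℝ)
    [IsProbabilityMeasure μ] (M : ENNReal) (hM : M ≠ ⊤) (hμM : μ ≤ M • volume)
    (hμ : ∀ᵐ s ∂μ, 0 < s ∧ s < 1) (x : EN N) (L : ℝ)
    (hL : HasFracLap N (2 * β) (phm β μ) x L) :
    ENNReal.ofReal L ≤ ENNReal.ofReal (fracLapCoeff N (2 * β)) *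
      ∫⁻ p, ENNReal.ofReal (E2 β x p) ∂(μ.prod (nu N β)) := by
  have hc := coeff_nonneg N β hβ
  unfold HasFracLap at hL
  set c := fracLapCoeff N (2 * β) with hcdef
  rcases hc.eq_or_lt with hc0 | hc0
  · rw [← hc0] at hL
    simp only [zero_mul] at hL
    have := tendsto_nhds_unique hL tendsto_const_nhds
    rw [this]; simp
  by_cases ht : ∫⁻ p, ENNReal.ofReal (E2 β x p) ∂(μ.prod (nu N β)) = ⊤
  · rw [ht, ENNReal.mul_top (by simpa using hc0)]
    exact le_top
  obtain ⟨i1, i1n⟩ := E1_int N hN β hβ hβ1 μ M hM hμM hμ x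
  have i2 : Integrable (E2 β x) (μ.prod (nu N β)) := by
    refine ⟨(E2_meas β x).aestronglyMeasurable, ?_⟩
    rw [hasFiniteIntegral_iff_ofReal (Eventually.of_forall (E2_nonneg β x))]
    exact lt_top_iff_ne_top.2 ht
  have hE : Integrable (fun p => E1 β x p + E2 β x p) (μ.prod (nu N β)) := i1.add i2
  have hseq : Tendsto (fun n : ℕ => 1 / ((n : ℝ) + 1)) atTop (𝓝[>] 0) :=
    tendsto_nhdsWithin_iff.2 ⟨tendsto_one_div_add_atTop_nhds_zero_nat,
      Eventually.of_forall fun n => by simp only [mem_Ioi]; positivity⟩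
  have t1 := hL.comp hseq
  have hmono : Monotone (fun n : ℕ => (univ : Set ℝ) ×ˢ An N (1 / ((n : ℝ) + 1))) := by
    intro m n hmn
    apply Set.prod_mono le_rfl
    intro y hy
    have : (1 : ℝ) / (n + 1) ≤ 1 / (m + 1) := by gcongr
    exact lt_of_le_of_lt this hy
  have hms : ∀ n : ℕ, MeasurableSet ((univ : Set ℝ) ×ˢ An N (1 / ((n : ℝ) + 1))) :=
    fun n => MeasurableSet.univ.prod (An_meas _ _)
  have t2 := tendsto_setIntegral_of_monotone hms hmono (f := fun p => E1 β x p + E2 β x p)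
    (μ := μ.prod (nu N β)) hE.integrableOn
  have hU : (⋃ n : ℕ, (univ : Set ℝ) ×ˢ An N (1 / ((n : ℝ) + 1))) = univ ×ˢ {0}ᶜ := by
    ext ⟨s, y⟩
    simp only [mem_iUnion, mem_prod, mem_univ, true_and, mem_compl_iff, mem_singleton_iff]
    constructor
    · rintro ⟨n, hn⟩ h0
      have hn' : (1 : ℝ) / (n + 1) < ‖y‖ := hn
      rw [h0, norm_zero] at hn'
      have : (0:ℝ) < 1 / (n + 1) := by positivity
      linarith
    · intro hy
      exact exists_nat_one_div_lt (norm_pos_iff.2 hy)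
  have hP : (μ.prod (nu N β)).restrict (univ ×ˢ {0}ᶜ) = μ.prod (nu N β) := by
    rw [← Measure.prod_restrict, Measure.restrict_univ]
    congr 1
    rw [Measure.restrict_eq_self_of_ae_mem]
    rw [ae_iff]
    simpa using nu_zero N hN β
  rw [hU, hP] at t2
  have t3 := t2.const_mul (c / 2)
  have hle : L ≤ c / 2 * ∫ p, (E1 β x p + E2 β x p) ∂(μ.prod (nu N β)) := by
    refine le_of_tendsto_of_tendsto' t1 t3 fun n => ?_
    have := trunc_le N hN β hβ μ hμ x (1 / ((n : ℝ) + 1)) (by positivity) hE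
    simp only [Function.comp]
    calc _ = c / 2 * (2 * ∫ y in {y : EN N | 1 / ((n : ℝ) + 1) < dist y x},
      (phm β μ y - phm β μ x) / dist y x ^ ((N : ℝ) + 2 * β)) := by ring
      _ ≤ _ := mul_le_mul_of_nonneg_left this (by positivity)
  rw [integral_add i1 i2] at hle
  have h2 : ∫ p, E2 β x p ∂(μ.prod (nu N β)) =
      (∫⁻ p, ENNReal.ofReal (E2 β x p) ∂(μ.prod (nu N β))).toReal :=
    integral_eq_lintegral_of_nonneg_ae (Eventually.of_forall (E2_nonneg β x))
      (E2_meas β x).aestronglyMeasurable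
  rw [← ENNReal.ofReal_toReal ht, ← ENNReal.ofReal_mul hc, ← h2]
  apply ENNReal.ofReal_le_ofReal
  have h3 : 0 ≤ ∫ p, E2 β x p ∂(μ.prod (nu N β)) := integral_nonneg (E2_nonneg β x)
  nlinarith

lemma fracLap_bound (N : ℕ) (hN : 3 ≤ N) (β : ℝ) (hβ : 0 < β) (hβ1 : β < 1) (μ : Measure ℝ)
    [IsProbabilityMeasure μ] (M : ENNReal) (hM : M ≠ ⊤) (hμM : μ ≤ M • volume)
    (hμ : ∀ᵐ s ∂μ, 0 < s ∧ s < 1) (x : EN N) :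
    ENNReal.ofReal (fracLap N (2 * β) (phm β μ) x) ≤ ENNReal.ofReal (fracLapCoeff N (2 * β)) *
      ∫⁻ p, ENNReal.ofReal (E2 β x p) ∂(μ.prod (nu N β)) := by
  unfold fracLap
  split_ifs with h
  · exact lap_bound N hN β hβ hβ1 μ M hM hμM hμ x _ h.choose_spec
  · simp

def q (β t s : ℝ) : ENNReal := if s < t ^ 2 then ENNReal.ofReal ((t - √s) ^ (-β)) else 0

lemma q_meas (β : ℝ) : Measurable fun p : ℝ × ℝ => q β p.1 p.2 := by
  unfold q
  exact Measurable.ite (measurableSet_lt (by fun_prop) (by fun_prop))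
    (Measurable.ennreal_ofReal (Measurable.pow_const (by fun_prop) _)) measurable_const

lemma E2_bound (N : ℕ) (hN : 3 ≤ N) (β : ℝ) (hβ : 0 < β) (hβ1 : β < 1) (μ : Measure ℝ)
    [IsProbabilityMeasure μ] (M : ENNReal) (hμM : μ ≤ M • volume)
    (hμ : ∀ᵐ s ∂μ, 0 < s ∧ s < 1) (x : EN N) :
    ∫⁻ p, ENNReal.ofReal (E2 β x p) ∂(μ.prod (nu N β)) ≤
      2 * (ENNReal.ofReal (2 / β) * (volume : Measure (EN N)).toSphere univ) * ∫⁻ s, q β ‖x‖ s ∂μ := by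
  have hne : ∀ᵐ s ∂μ, s ≠ ‖x‖ ^ 2 := by
    rw [ae_iff]
    simp only [ne_eq, not_not]
    have h0 := hμM {s | s = ‖x‖ ^ 2}
    simpa using h0
  rw [lintegral_prod _ (E2_meas β x).ennreal_ofReal.aemeasurable, ← lintegral_const_mul' _ _
    (ENNReal.mul_ne_top (by simp) (ENNReal.mul_ne_top ENNReal.ofReal_ne_top (measure_ne_top _ _)))]
  apply lintegral_mono_ae
  filter_upwards [hμ, hne] with s hs hsx
  by_cases h : ‖x‖ ^ 2 < s
  · simp [E2, h]
  have h' : s < ‖x‖ ^ 2 := lt_of_le_of_ne (not_lt.1 h) hsx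
  simp only [E2, if_neg h, q, if_pos h']
  have m1 : Measurable fun y : EN N => ph β s (x + y) := ph_comp β _ _ measurable_const (by fun_prop)
  have m2 : Measurable fun y : EN N => ph β s (x - y) := ph_comp β _ _ measurable_const (by fun_prop)
  have b1 := ph_tail N hN β s hβ hβ1 hs.1 hs.2 x h' (fun y => x + y) (by fun_prop) (by simp)
  have b2 := ph_tail N hN β s hβ hβ1 hs.1 hs.2 x h' (fun y => x - y) (by fun_prop) (by simp)
  calc _ ≤ ∫⁻ y, (ENNReal.ofReal (ph β s (x + y)) + ENNReal.ofReal (ph β s (x - y))) ∂(nu N β) := by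
        apply lintegral_mono; intro y; exact ENNReal.ofReal_add_le
    _ = _ := lintegral_add_left m1.ennreal_ofReal _
    _ ≤ _ := by
        rw [nu_lint N β _ m1, nu_lint N β _ m2, mul_assoc, two_mul (_ * _ : ENNReal)]
        exact add_le_add b1 b2

lemma lint_right (a p : ℝ) (ha : a < 1) (hp : -1 < p) :
    ∫⁻ r in Ioo a 1, ENNReal.ofReal ((r - a) ^ p) = ENNReal.ofReal ((1 - a) ^ (p + 1) / (p + 1)) := by
  have h1 : IntervalIntegrable (fun s : ℝ => s ^ p) volume 0 (1 - a) :=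
    intervalIntegral.intervalIntegrable_rpow' hp
  have h2 := h1.comp_sub_right a
  simp only [zero_add, sub_add_cancel] at h2
  rw [intervalIntegrable_iff_integrableOn_Ioo_of_le ha.le] at h2
  rw [← ofReal_integral_eq_lintegral_ofReal h2]
  · rw [← integral_Ioc_eq_integral_Ioo, ← intervalIntegral.integral_of_le ha.le,
      intervalIntegral.integral_comp_sub_right (fun s : ℝ => s ^ p) a, sub_self,
      integral_rpow (Or.inl hp), Real.zero_rpow (by linarith), sub_zero]
  · filter_upwards [ae_restrict_mem measurableSet_Ioo] with r hr
    exact Real.rpow_nonneg (by linarith [hr.1]) _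

lemma lint_left (a p : ℝ) (ha : a < 1) (hp : -1 < p) :
    ∫⁻ r in Ioo a 1, ENNReal.ofReal ((1 - r) ^ p) = ENNReal.ofReal ((1 - a) ^ (p + 1) / (p + 1)) := by
  have h1 : IntervalIntegrable (fun s : ℝ => s ^ p) volume (1 - a) 0 :=
    intervalIntegral.intervalIntegrable_rpow' hp
  have h2 := h1.comp_sub_left 1
  simp only [sub_zero, sub_sub_cancel] at h2
  rw [intervalIntegrable_iff_integrableOn_Ioo_of_le ha.le] at h2
  rw [← ofReal_integral_eq_lintegral_ofReal h2]
  · rw [← integral_Ioc_eq_integral_Ioo, ← intervalIntegral.integral_of_le ha.le,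
      intervalIntegral.integral_comp_sub_left (fun s : ℝ => s ^ p) 1, sub_self,
      integral_rpow (Or.inl hp), Real.zero_rpow (by linarith), sub_zero]
  · filter_upwards [ae_restrict_mem measurableSet_Ioo] with r hr
    exact Real.rpow_nonneg (by linarith [hr.2]) _

lemma beta_lint (β : ℝ) (hβ : 0 < β) (hβ1 : β < 1) (a : ℝ) (ha : a < 1) :
    ∫⁻ r in Ioo a 1, ENNReal.ofReal ((1 - r) ^ (β - 1) * (r - a) ^ (-β)) ≤
      ENNReal.ofReal (2 / (1 - β) + 2 / β) := by
  set m := (1 - a) / 2 with hm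
  have hm0 : 0 < m := by rw [hm]; linarith
  have e2 : 1 - a = 2 * m := by rw [hm]; ring
  have two_le : ∀ p : ℝ, p ≤ 1 → (2:ℝ) ^ p ≤ 2 := fun p hp => by
    calc (2:ℝ) ^ p ≤ 2 ^ (1:ℝ) := Real.rpow_le_rpow_of_exponent_le (by norm_num) hp
      _ = 2 := by norm_num
  calc _ ≤ ∫⁻ r in Ioo a 1, (ENNReal.ofReal (m ^ (β - 1)) * ENNReal.ofReal ((r - a) ^ (-β)) +
          ENNReal.ofReal (m ^ (-β)) * ENNReal.ofReal ((1 - r) ^ (β - 1))) := by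
        apply setLIntegral_mono' measurableSet_Ioo
        intro r hr
        have h1 : 0 < r - a := by linarith [hr.1]
        have h2 : 0 < 1 - r := by linarith [hr.2]
        rw [← ENNReal.ofReal_mul (by positivity), ← ENNReal.ofReal_mul (by positivity),
          ← ENNReal.ofReal_add (by positivity) (by positivity)]
        apply ENNReal.ofReal_le_ofReal
        by_cases h : m ≤ 1 - r
        · have : (1 - r) ^ (β - 1) ≤ m ^ (β - 1) :=
            Real.rpow_le_rpow_of_nonpos hm0 h (by linarith)
          have h3 : (1 - r) ^ (β - 1) * (r - a) ^ (-β) ≤ m ^ (β - 1) * (r - a) ^ (-β) := by gcongr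
          have h4 : 0 ≤ m ^ (-β) * (1 - r) ^ (β - 1) := by positivity
          linarith
        · have : (r - a) ^ (-β) ≤ m ^ (-β) :=
            Real.rpow_le_rpow_of_nonpos hm0 (by push Not at h; linarith) (by linarith)
          have h3 : (1 - r) ^ (β - 1) * (r - a) ^ (-β) ≤ (1 - r) ^ (β - 1) * m ^ (-β) := by gcongr
          have h4 : 0 ≤ m ^ (β - 1) * (r - a) ^ (-β) := by positivity
          linarith
    _ = ENNReal.ofReal (m ^ (β - 1)) * ENNReal.ofReal ((1 - a) ^ (-β + 1) / (-β + 1)) +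
        ENNReal.ofReal (m ^ (-β)) * ENNReal.ofReal ((1 - a) ^ (β - 1 + 1) / (β - 1 + 1)) := by
        rw [lintegral_add_left (Measurable.const_mul (Measurable.ennreal_ofReal
          (Measurable.pow_const (by fun_prop) _)) _), lintegral_const_mul' _ _ ENNReal.ofReal_ne_top,
          lintegral_const_mul' _ _ ENNReal.ofReal_ne_top, lint_right a _ ha (by linarith),
          lint_left a _ ha (by linarith)]
    _ ≤ _ := by
        have hb : 0 < 1 - β := by linarith
        rw [e2, ← ENNReal.ofReal_mul (by positivity), ← ENNReal.ofReal_mul (by positivity),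
          show -β + 1 = 1 - β by ring, show β - 1 + 1 = β by ring,
          ← ENNReal.ofReal_add (by positivity) (by positivity)]
        apply ENNReal.ofReal_le_ofReal
        have c1 : m ^ (β - 1) * m ^ (1 - β) = 1 := by
          rw [← Real.rpow_add hm0]; simp
        have c2 : m ^ (-β) * m ^ β = 1 := by
          rw [← Real.rpow_add hm0]; simp
        rw [Real.mul_rpow (by norm_num) hm0.le, Real.mul_rpow (by norm_num) hm0.le]
        have d1 : m ^ (β - 1) * (2 ^ (1 - β) * m ^ (1 - β) / (1 - β)) = 2 ^ (1 - β) / (1 - β) := by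
          calc _ = (m ^ (β - 1) * m ^ (1 - β)) * (2 ^ (1 - β) / (1 - β)) := by ring
            _ = _ := by rw [c1, one_mul]
        have d2 : m ^ (-β) * (2 ^ β * m ^ β / β) = 2 ^ β / β := by
          calc _ = (m ^ (-β) * m ^ β) * (2 ^ β / β) := by ring
            _ = _ := by rw [c2, one_mul]
        rw [d1, d2]
        have := two_le (1 - β) (by linarith)
        have := two_le β hβ1.le
        gcongr

lemma u_bound (N : ℕ) (β γ : ℝ) (hβ1 : β < 1) (g : sphere (0 : EN N) 1 → ℝ) (u : EN N → ℝ)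
    (hu : IsSolutionPg N (2 * β) γ g u) :
    ∃ C : ℝ, 0 ≤ C ∧ ∀ x : EN N, ‖x‖ < 1 → u x ≤ C * (1 - ‖x‖) ^ (β - 1) := by
  obtain ⟨h0, -, hz, ⟨-, hc, -, -⟩, hb⟩ := hu
  have e : 1 - 2 * β / 2 = 1 - β := by ring
  rw [e] at hb
  have key : ∃ C : ℝ, ∀ x ∈ closedBall (0 : EN N) 1, ‖x‖ < 1 → delta1 x ^ (1 - β) * u x ≤ C := by
    refine IsCompact.induction_on (p := fun s => ∃ C : ℝ, ∀ x ∈ s, ‖x‖ < 1 →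
      delta1 x ^ (1 - β) * u x ≤ C) (isCompact_closedBall (0 : EN N) 1) ?_ ?_ ?_ ?_
    · exact ⟨0, by simp⟩
    · rintro s t hst ⟨C, hC⟩
      exact ⟨C, fun x hx => hC x (hst hx)⟩
    · rintro s t ⟨C, hC⟩ ⟨D, hD⟩
      refine ⟨max C D, ?_⟩
      rintro x (hx | hx) h1
      · exact (hC x hx h1).trans (le_max_left _ _)
      · exact (hD x hx h1).trans (le_max_right _ _)
    · intro z hz1
      have hz2 : ‖z‖ ≤ 1 := by simpa using hz1
      rcases hz2.eq_or_lt with h1 | h1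
      · have hzs : z ∈ sphere (0 : EN N) 1 := by simpa using h1
        have ht := (hb ⟨z, hzs⟩).eventually_lt_const (lt_add_one (g ⟨z, hzs⟩))
        rw [eventually_nhdsWithin_iff] at ht
        refine ⟨_, mem_nhdsWithin_of_mem_nhds ht, g ⟨z, hzs⟩ + 1, ?_⟩
        intro x hx hx1
        exact (hx (by simpa using hx1)).le
      · have hzb : z ∈ ball (0 : EN N) 1 := by simpa using h1
        have hcz : ContinuousAt u z := hc.continuousAt (isOpen_ball.mem_nhds hzb)
        have ht := hcz.eventually_lt continuousAt_const (lt_add_one (u z))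
        refine ⟨_, mem_nhdsWithin_of_mem_nhds ht, u z + 1, ?_⟩
        intro x hx hx1
        have hx' : u x < u z + 1 := hx
        have : delta1 x ^ (1 - β) ≤ 1 := by
          rw [delta1, if_pos hx1]
          exact Real.rpow_le_one (by linarith) (by linarith [norm_nonneg x]) (by linarith)
        nlinarith [h0 x]
  obtain ⟨C, hC⟩ := key
  refine ⟨max C 0, le_max_right _ _, ?_⟩
  intro x hx
  have h1 := hC x (by simpa using hx.le) hx
  rw [delta1, if_pos hx] at h1
  have hp : 0 < 1 - ‖x‖ := by linarith
  have h2 : (1 - ‖x‖) ^ (β - 1) * (1 - ‖x‖) ^ (1 - β) = 1 := by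
    rw [← Real.rpow_add hp]; simp
  have h3 : 0 ≤ (1 - ‖x‖) ^ (β - 1) := by positivity
  calc u x = ((1 - ‖x‖) ^ (1 - β) * u x) * (1 - ‖x‖) ^ (β - 1) := by
        linear_combination -(u x) * h2
    _ ≤ max C 0 * (1 - ‖x‖) ^ (β - 1) := by
        gcongr
        exact h1.trans (le_max_left _ _)

/-- boundary weight -/
def wt (β t : ℝ) : ENNReal := if t < 1 then ENNReal.ofReal ((1 - t) ^ (β - 1)) else 0

lemma wt_meas (β : ℝ) : Measurable (wt β) := by
  unfold wt
  exact Measurable.ite (measurableSet_lt measurable_id measurable_const)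
    (Measurable.ennreal_ofReal (Measurable.pow_const (by fun_prop) _)) measurable_const

lemma wq_bound (N : ℕ) (hN : 3 ≤ N) (β : ℝ) (hβ : 0 < β) (hβ1 : β < 1) (s : ℝ) (hs : 0 < s ∧ s < 1) :
    ∫⁻ x : EN N, wt β ‖x‖ * q β ‖x‖ s ≤
      ENNReal.ofReal (2 / (1 - β) + 2 / β) * (volume : Measure (EN N)).toSphere univ := by
  have m1 : Measurable fun x : EN N => wt β ‖x‖ := (wt_meas β).comp measurable_norm
  have m2 : Measurable fun t : ℝ => q β t s :=
    Measurable.comp (q_meas β) (f := fun t : ℝ => (t, s)) (by fun_prop)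
  have m3 : Measurable fun x : EN N => q β ‖x‖ s := m2.comp measurable_norm
  have m4 : Measurable fun x : EN N => wt β ‖x‖ * q β ‖x‖ s := m1.mul m3
  refine polar_le N hN (fun x : EN N => wt β ‖x‖ * q β ‖x‖ s) m4 _ ?_
  intro θ hθ
  have hs1 : √s < 1 := by rw [Real.sqrt_lt' one_pos]; linarith [hs.2]
  refine le_trans ?_ (beta_lint β hβ hβ1 (√s) hs1)
  rw [← lintegral_indicator measurableSet_Ioi, ← lintegral_indicator measurableSet_Ioo]
  apply lintegral_mono
  intro r
  by_cases hr : 0 < r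
  · have hn : ‖r • θ‖ = r := by rw [norm_smul, hθ, mul_one, Real.norm_eq_abs, abs_of_pos hr]
    simp only [indicator_of_mem (mem_Ioi.2 hr), hn, wt, q]
    by_cases h1 : r < 1
    · by_cases h2 : s < r ^ 2
      · have h3 : √s < r := by rwa [Real.sqrt_lt' hr]
        rw [indicator_of_mem (mem_Ioo.2 ⟨h3, h1⟩), if_pos h1, if_pos h2,
          ← ENNReal.ofReal_mul (Real.rpow_nonneg (by linarith) _)]
        calc _ ≤ 1 * ENNReal.ofReal ((1 - r) ^ (β - 1) * (r - √s) ^ (-β)) := by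
              refine mul_le_mul' ?_ le_rfl
              rw [← ENNReal.ofReal_one]
              exact ENNReal.ofReal_le_ofReal (pow_le_one₀ hr.le h1.le)
          _ = _ := one_mul _
      · simp [h2]
    · simp [h1]
  · simp [hr]

/-- uniform bound of the left-hand side -/
lemma lhs_bound (N : ℕ) (hN : 3 ≤ N) (β γ : ℝ) (hβ : 0 < β) (hβ1 : β < 1)
    (g : sphere (0 : EN N) 1 → ℝ) (u : EN N → ℝ) (hu : IsSolutionPg N (2 * β) γ g u) :
    ∃ K : ℝ, 0 ≤ K ∧ ∀ (μ : Measure ℝ) (_ : IsProbabilityMeasure μ) (M : ENNReal), M ≠ ⊤ →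
      μ ≤ M • volume → (∀ᵐ s ∂μ, 0 < s ∧ s < 1) →
      ∫ x, u x * fracLap N (2 * β) (phm β μ) x ≤ K := by
  obtain ⟨Cu, hCu, hub⟩ := u_bound N β γ hβ1 g u hu
  obtain ⟨h0, -, hz, -, -⟩ := hu
  set c := ENNReal.ofReal (fracLapCoeff N (2 * β))
  set σ := (volume : Measure (EN N)).toSphere univ
  have hσ : σ < ⊤ := measure_lt_top _ _
  set C2 : ENNReal := 2 * (ENNReal.ofReal (2 / β) * σ)
  set C1 : ENNReal := ENNReal.ofReal Cu * (c * C2)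
  set K0 := ENNReal.ofReal (2 / (1 - β) + 2 / β)
  have hC2 : C2 < ⊤ := ENNReal.mul_lt_top (by simp) (ENNReal.mul_lt_top ENNReal.ofReal_lt_top hσ)
  have hC1 : C1 < ⊤ := ENNReal.mul_lt_top ENNReal.ofReal_lt_top
    (ENNReal.mul_lt_top ENNReal.ofReal_lt_top hC2)
  have hK : C1 * (K0 * σ) < ⊤ := ENNReal.mul_lt_top hC1 (ENNReal.mul_lt_top ENNReal.ofReal_lt_top hσ)
  refine ⟨(C1 * (K0 * σ)).toReal, ENNReal.toReal_nonneg, ?_⟩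
  intro μ _ M hM hμM hμ
  have hqm : Measurable fun p : EN N × ℝ => wt β ‖p.1‖ * q β ‖p.1‖ p.2 := by
    have m1 : Measurable fun p : EN N × ℝ => wt β ‖p.1‖ :=
      (wt_meas β).comp (by fun_prop : Measurable fun p : EN N × ℝ => ‖p.1‖)
    have m2 : Measurable fun p : EN N × ℝ => q β ‖p.1‖ p.2 :=
      Measurable.comp (q_meas β) (f := fun p : EN N × ℝ => (‖p.1‖, p.2)) (by fun_prop)
    exact m1.mul m2
  have hl : ∫⁻ x, ENNReal.ofReal (u x * fracLap N (2 * β) (phm β μ) x) ≤ C1 * (K0 * σ) := by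
    calc _ ≤ ∫⁻ x : EN N, C1 * ∫⁻ s, wt β ‖x‖ * q β ‖x‖ s ∂μ := by
          apply lintegral_mono
          intro x
          simp only
          by_cases hx : ‖x‖ < 1
          · rw [ENNReal.ofReal_mul (h0 x)]
            have b1 := fracLap_bound N hN β hβ hβ1 μ M hM hμM hμ x
            have b2 := E2_bound N hN β hβ hβ1 μ M hμM hμ x
            have b3 : ENNReal.ofReal (u x) ≤ ENNReal.ofReal Cu * wt β ‖x‖ := by
              simp only [wt, if_pos hx]
              rw [← ENNReal.ofReal_mul hCu]
              exact ENNReal.ofReal_le_ofReal (hub x hx)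
            have hwt : wt β ‖x‖ ≠ ⊤ := by simp only [wt, if_pos hx]; exact ENNReal.ofReal_ne_top
            rw [lintegral_const_mul' _ _ hwt]
            calc _ ≤ (ENNReal.ofReal Cu * wt β ‖x‖) * (c * (C2 * ∫⁻ s, q β ‖x‖ s ∂μ)) :=
                  mul_le_mul' b3 (b1.trans (mul_le_mul' le_rfl b2))
              _ = _ := by simp only [C1]; ring
          · rw [hz x hx, zero_mul, ENNReal.ofReal_zero]; exact bot_le
      _ = C1 * ∫⁻ s, ∫⁻ x : EN N, wt β ‖x‖ * q β ‖x‖ s ∂volume ∂μ := by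
          rw [lintegral_const_mul' _ _ hC1.ne]
          congr 1
          exact lintegral_lintegral_swap hqm.aemeasurable
      _ ≤ C1 * ∫⁻ s, K0 * σ ∂μ := by
          refine mul_le_mul' le_rfl (lintegral_mono_ae ?_)
          filter_upwards [hμ] with s hs
          exact wq_bound N hN β hβ hβ1 s hs
      _ = C1 * (K0 * σ) := by rw [lintegral_const]; simp
  by_cases hi : Integrable (fun x => u x * fracLap N (2 * β) (phm β μ) x)
  · rw [integral_eq_lintegral_pos_part_sub_lintegral_neg_part hi]
    have := ENNReal.toReal_mono hK.ne hl
    have h2 : 0 ≤ (∫⁻ x, ENNReal.ofReal (-(u x * fracLap N (2 * β) (phm β μ) x))).toReal :=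
      ENNReal.toReal_nonneg
    linarith
  · rw [integral_undef hi]; exact ENNReal.toReal_nonneg

open scoped Convolution in
lemma test_fun (N : ℕ) (β : ℝ) (hβ : 0 < β) (s1 : ℝ) (h0 : 0 < s1) (h1 : s1 < 1) :
    ∃ (μ : Measure ℝ) (_ : IsProbabilityMeasure μ) (M : ENNReal), M ≠ ⊤ ∧ μ ≤ M • volume ∧
      (∀ᵐ s ∂μ, 0 < s ∧ s < 1) ∧ ContDiff ℝ (⊤ : ℕ∞) (phm (N := N) β μ) ∧
      HasCompactSupport (phm (N := N) β μ) ∧ tsupport (phm (N := N) β μ) ⊆ ball 0 1 ∧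
      (∀ x : EN N, 0 ≤ phm β μ x) ∧ (∀ x : EN N, ph β s1 x ≤ phm β μ x) := by
  let f : ContDiffBump ((1 + s1) / 2 : ℝ) := ⟨(1 - s1) / 8, (1 - s1) / 4, by linarith, by linarith⟩
  set ρ : ℝ → ℝ := f.normed volume with hρ
  have hρc : Continuous ρ := f.continuous_normed
  have hρ0 : ∀ s, 0 ≤ ρ s := fun s => f.nonneg_normed s
  have hsupp : ∀ s, ρ s ≠ 0 → s1 < s ∧ s < (3 + s1) / 4 := by
    intro s hs
    have : s ∈ Function.support ρ := hs
    rw [hρ, f.support_normed_eq] at this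
    have h2 : |s - (1 + s1) / 2| < (1 - s1) / 4 := this
    rw [abs_lt] at h2
    constructor <;> linarith
  set μ : Measure ℝ := volume.withDensity fun s => ENNReal.ofReal (ρ s) with hμdef
  have hmρ : Measurable fun s => ENNReal.ofReal (ρ s) := hρc.measurable.ennreal_ofReal
  have hprob : IsProbabilityMeasure μ := by
    constructor
    rw [hμdef, withDensity_apply _ MeasurableSet.univ, Measure.restrict_univ,
      ← ofReal_integral_eq_lintegral_ofReal f.integrable_normed (Eventually.of_forall hρ0),
      f.integral_normed, ENNReal.ofReal_one]
  have hae : ∀ᵐ s ∂μ, s1 < s ∧ s < (3 + s1) / 4 := by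
    rw [hμdef, ae_withDensity_iff hmρ]
    refine Eventually.of_forall fun s hs => hsupp s ?_
    intro h; rw [h] at hs; simp at hs
  have hae' : ∀ᵐ s ∂μ, 0 < s ∧ s < 1 := by
    filter_upwards [hae] with s hs
    constructor <;> linarith [hs.1, hs.2]
  have hM : μ ≤ ENNReal.ofReal (1 / volume.real (closedBall ((1 + s1) / 2 : ℝ) f.rIn)) • volume := by
    rw [← withDensity_const]
    apply withDensity_mono
    refine Eventually.of_forall fun s => ?_
    exact ENNReal.ofReal_le_ofReal (f.normed_le_div_measure_closedBall_rIn volume s)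
  have hzero : ∀ x : EN N, (3 + s1) / 4 ≤ ‖x‖ ^ 2 → phm β μ x = 0 := by
    intro x hx
    unfold phm
    rw [integral_eq_zero_of_ae]
    filter_upwards [hae] with s hs
    exact ph_eq_zero β s hβ x (by linarith [hs.2])
  have hnn : ∀ x : EN N, 0 ≤ phm β μ x := fun x => integral_nonneg fun s => ph_nonneg β s x
  refine ⟨μ, hprob, _, ENNReal.ofReal_ne_top, hM, hae', ?_, ?_, ?_, hnn, ?_⟩
  · have hF : Continuous fun τ : ℝ => max (-τ) 0 ^ β :=
      (continuous_neg.max continuous_const).rpow_const fun _ => Or.inr hβ.le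
    have hconv : ContDiff ℝ (⊤ : ℕ∞) (ρ ⋆[ContinuousLinearMap.lsmul ℝ ℝ, volume]
        (fun τ : ℝ => max (-τ) 0 ^ β)) :=
      HasCompactSupport.contDiff_convolution_left _ f.hasCompactSupport_normed f.contDiff_normed
        hF.locallyIntegrable
    have he : phm (N := N) β μ = (ρ ⋆[ContinuousLinearMap.lsmul ℝ ℝ, volume]
        (fun τ : ℝ => max (-τ) 0 ^ β)) ∘ (fun x : EN N => ‖x‖ ^ 2) := by
      funext x
      simp only [Function.comp, convolution, phm]
      rw [hμdef, integral_withDensity_eq_integral_toReal_smul hmρ (by simp)]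
      congr 1
      funext s
      rw [ENNReal.toReal_ofReal (hρ0 s)]
      simp [ph]
    rw [he]
    exact hconv.comp (contDiff_norm_sq ℝ)
  · apply HasCompactSupport.intro (isCompact_closedBall (0 : EN N) 1)
    intro x hx
    apply hzero
    have : 1 < ‖x‖ := by simpa using hx
    nlinarith
  · have hcl : IsClosed {x : EN N | ‖x‖ ^ 2 ≤ (3 + s1) / 4} :=
      isClosed_le (by fun_prop) continuous_const
    have : tsupport (phm (N := N) β μ) ⊆ {x : EN N | ‖x‖ ^ 2 ≤ (3 + s1) / 4} := by
      apply closure_minimal _ hcl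
      intro x hx
      by_contra h
      apply hx
      apply hzero
      exact (not_le.1 h).le
    intro x hx
    have h2 : ‖x‖ ^ 2 ≤ (3 + s1) / 4 := this hx
    have : ‖x‖ < 1 := by nlinarith [norm_nonneg x]
    simpa using this
  · intro x
    have hi := ph_int β hβ μ hae' x
    calc ph β s1 x = ∫ _, ph β s1 x ∂μ := by simp
      _ ≤ phm β μ x := by
        apply integral_mono_ae (integrable_const _) hi
        filter_upwards [hae] with s hs
        unfold ph
        apply Real.rpow_le_rpow (le_max_right _ _) _ hβ.le
        apply max_le_max _ le_rfl
        linarith [hs.1]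

lemma rhs_bound (N : ℕ) (hN : 3 ≤ N) (β γ : ℝ) (hβ : 0 < β) (hβ1 : β < 1) (hγ : 0 ≤ γ)
    (g : sphere (0 : EN N) 1 → ℝ) (u : EN N → ℝ) (hu : IsSolutionPg N (2 * β) γ g u) :
    ∃ K : ENNReal, K < ⊤ ∧ ∀ s, 0 < s → s < 1 →
      ∫⁻ x, ENNReal.ofReal (u x ^ γ * ph β s x) ≤ K := by
  obtain ⟨K, hK0, hK⟩ := lhs_bound N hN β γ hβ hβ1 g u hu
  obtain ⟨h0, -, hz, ⟨-, hc, -, hsol⟩, -⟩ := hu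
  refine ⟨ENNReal.ofReal K, ENNReal.ofReal_lt_top, ?_⟩
  intro s hs0 hs1
  obtain ⟨μ, hp, M, hM, hμM, hμ, hsm, hcs, hts, hnn, hge⟩ := test_fun N β hβ s hs0 hs1
  have e := hsol _ hsm hcs hts hnn
  have b := hK μ hp M hM hμM hμ
  rw [e] at b
  have hi : Integrable (fun x => u x ^ γ * phm β μ x) := by
    have h1 : ContinuousOn (fun x => u x ^ γ * phm β μ x) (tsupport (phm (N := N) β μ)) :=
      ((hc.mono hts).rpow_const fun x _ => Or.inr hγ).mul hsm.continuous.continuousOn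
    have h2 := h1.integrableOn_compact hcs (μ := volume)
    refine (integrableOn_iff_integrable_of_support_subset ?_).1 h2
    intro x hx
    apply subset_tsupport
    intro h
    apply hx
    simp [h]
  calc _ ≤ ∫⁻ x, ENNReal.ofReal (u x ^ γ * phm β μ x) := by
        apply lintegral_mono
        intro x
        apply ENNReal.ofReal_le_ofReal
        exact mul_le_mul_of_nonneg_left (hge x) (Real.rpow_nonneg (h0 x) _)
    _ = ENNReal.ofReal (∫ x, u x ^ γ * phm β μ x) := by
        rw [ofReal_integral_eq_lintegral_ofReal hi]
        exact Eventually.of_forall fun x => mul_nonneg (Real.rpow_nonneg (h0 x) _) (hnn x)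
    _ ≤ _ := ENNReal.ofReal_le_ofReal b

lemma inv_lint_top (η : ℝ) (hη : 0 < η) :
    ∫⁻ r in Ioo (1 - η) 1, ENNReal.ofReal ((1 - r)⁻¹) = ⊤ := by
  by_contra h
  have hi : IntegrableOn (fun r : ℝ => (1 - r)⁻¹) (Ioo (1 - η) 1) := by
    refine ⟨Measurable.aestronglyMeasurable (by fun_prop), ?_⟩
    rw [hasFiniteIntegral_iff_ofReal]
    · exact lt_top_iff_ne_top.2 h
    · filter_upwards [ae_restrict_mem measurableSet_Ioo] with r hr
      simp only [Pi.zero_apply, inv_nonneg]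
      linarith [hr.2]
  have h2 : IntervalIntegrable (fun r : ℝ => (r - 1)⁻¹) volume (1 - η) 1 := by
    rw [intervalIntegrable_iff_integrableOn_Ioo_of_le (by linarith)]
    have := hi.neg
    refine this.congr_fun (fun r _ => ?_) measurableSet_Ioo
    simp only [Pi.neg_apply]
    rw [← inv_neg, neg_sub]
  rw [intervalIntegrable_sub_inv_iff] at h2
  rcases h2 with h2 | h2
  · linarith
  · exact h2 right_mem_uIcc

lemma diverge (N : ℕ) (hN : 3 ≤ N) (z : sphere (0 : EN N) 1) (r0 k : ℝ) (hr0 : 0 < r0) (hk : 0 < k) :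
    ∫⁻ x, (ball (0 : EN N) 1 ∩ ball (z : EN N) r0).indicator
      (fun x => ENNReal.ofReal (k * (1 - ‖x‖)⁻¹)) x = ⊤ := by
  have hV : MeasurableSet (ball (0 : EN N) 1 ∩ ball (z : EN N) r0) :=
    measurableSet_ball.inter measurableSet_ball
  rw [polar N hN _ (Measurable.indicator (by fun_prop) hV)]
  set η := min (r0 / 2) (1 / 2) with hη
  have hη0 : 0 < η := by positivity
  set T : Set (sphere (0 : EN N) 1) := ball z (r0 / 2) with hT
  have hTpos : (volume : Measure (EN N)).toSphere T ≠ 0 :=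
    (isOpen_ball.measure_pos _ ⟨z, mem_ball_self (by positivity)⟩).ne'
  rw [eq_top_iff]
  calc (⊤ : ENNReal) = ∫⁻ _ in T, ⊤ ∂((volume : Measure (EN N)).toSphere) := by
        rw [setLIntegral_const, ENNReal.top_mul hTpos]
    _ ≤ ∫⁻ θ in T, (∫⁻ r in Ioi (0:ℝ), ENNReal.ofReal (r ^ (N - 1)) *
          (ball (0 : EN N) 1 ∩ ball (z : EN N) r0).indicator
      (fun x => ENNReal.ofReal (k * (1 - ‖x‖)⁻¹)) (r • (θ : EN N))) ∂((volume : Measure (EN N)).toSphere) := by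
        apply setLIntegral_mono' measurableSet_ball
        intro θ hθ
        have hn : ‖(θ : EN N)‖ = 1 := by simp
        have hθz : dist (θ : EN N) z < r0 / 2 := hθ
        calc (⊤ : ENNReal) = ENNReal.ofReal ((1 / 2) ^ (N - 1) * k) *
              ∫⁻ r in Ioo (1 - η) 1, ENNReal.ofReal ((1 - r)⁻¹) := by
              rw [inv_lint_top η hη0, ENNReal.mul_top]
              simpa using by positivity
          _ = ∫⁻ r in Ioo (1 - η) 1, ENNReal.ofReal ((1 / 2) ^ (N - 1) * k) *
              ENNReal.ofReal ((1 - r)⁻¹) := by rw [lintegral_const_mul' _ _ ENNReal.ofReal_ne_top]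
          _ ≤ ∫⁻ r in Ioo (1 - η) 1, ENNReal.ofReal (r ^ (N - 1)) *
              (ball (0 : EN N) 1 ∩ ball (z : EN N) r0).indicator
              (fun x => ENNReal.ofReal (k * (1 - ‖x‖)⁻¹)) (r • (θ : EN N)) := by
              apply setLIntegral_mono' measurableSet_Ioo
              intro r hr
              have hη1 : η ≤ 1 / 2 := min_le_right _ _
              have hη2 : η ≤ r0 / 2 := min_le_left _ _
              have hr1 : 1 / 2 < r := by linarith [hr.1]
              have hrn : ‖r • (θ : EN N)‖ = r := by
                rw [norm_smul, hn, mul_one, Real.norm_eq_abs, abs_of_pos (by linarith)]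
              have hmem : r • (θ : EN N) ∈ ball (0 : EN N) 1 ∩ ball (z : EN N) r0 := by
                constructor
                · rw [mem_ball_zero_iff, hrn]; exact hr.2
                · rw [mem_ball]
                  have : dist (r • (θ : EN N)) θ = 1 - r := by
                    rw [dist_eq_norm, show r • (θ : EN N) - θ = (r - 1) • (θ : EN N) by
                      rw [sub_smul, one_smul], norm_smul, hn, mul_one, Real.norm_eq_abs, abs_sub_comm,
                      abs_of_pos (by linarith [hr.2])]
                  have := dist_triangle (r • (θ : EN N)) θ z
                  linarith [hr.1]
              rw [indicator_of_mem hmem, hrn, ← ENNReal.ofReal_mul (by positivity),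
                ← ENNReal.ofReal_mul (by positivity)]
              apply ENNReal.ofReal_le_ofReal
              have : 0 < (1 - r)⁻¹ := inv_pos.2 (by linarith [hr.2])
              rw [mul_assoc]
              gcongr
          _ ≤ _ := by
              apply lintegral_mono_set
              intro r hr
              have hη1 : η ≤ 1 / 2 := min_le_right _ _
              exact mem_Ioi.2 (by linarith [hr.1])
    _ ≤ _ := setLIntegral_le_lintegral _ _

lemma main_aux (N : ℕ) (hN : 3 ≤ N) (β γ : ℝ) (hβ : 0 < β) (hβ1 : β < 1)
    (hγ : 1 + β ≤ (1 - β) * γ)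
    (g : sphere (0 : EN N) 1 → ℝ) (z : sphere (0 : EN N) 1) (hz : 0 < g z) (u : EN N → ℝ)
    (hu : IsSolutionPg N (2 * β) γ g u) : False := by
  have hγ0 : 0 ≤ γ := by
    by_contra h
    nlinarith
  obtain ⟨K, hKt, hK⟩ := rhs_bound N hN β γ hβ hβ1 hγ0 g u hu
  obtain ⟨h0, -, -, -, hb⟩ := hu
  have hev := (hb z).eventually_const_lt (half_lt_self hz)
  rw [show 1 - 2 * β / 2 = 1 - β by ring, eventually_nhdsWithin_iff, Metric.eventually_nhds_iff_ball] at hev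
  obtain ⟨r0, hr0, hev⟩ := hev
  set κ := g z / 2 with hκ
  have hκ0 : 0 < κ := by positivity
  set V := ball (0 : EN N) 1 ∩ ball (z : EN N) r0 with hVdef
  have hV : MeasurableSet V := measurableSet_ball.inter measurableSet_ball
  have hlow : ∀ x ∈ V, κ ^ γ * (1 - ‖x‖) ^ (-1 - β) ≤ u x ^ γ := by
    intro x hx
    have hx1 : ‖x‖ < 1 := by simpa using hx.1
    have hp : 0 < 1 - ‖x‖ := by linarith
    have h1 := hev x hx.2 hx.1
    rw [delta1, if_pos hx1] at h1
    have h2 : (1 - ‖x‖) ^ (-(1 - β)) * (1 - ‖x‖) ^ (1 - β) = 1 := by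
      rw [← Real.rpow_add hp]; simp
    have h3 : 0 < (1 - ‖x‖) ^ (-(1 - β)) := by positivity
    have h4 : κ * (1 - ‖x‖) ^ (-(1 - β)) ≤ u x := by
      calc κ * (1 - ‖x‖) ^ (-(1 - β)) ≤ ((1 - ‖x‖) ^ (1 - β) * u x) * (1 - ‖x‖) ^ (-(1 - β)) := by
            gcongr
        _ = u x := by linear_combination (u x) * h2
    calc κ ^ γ * (1 - ‖x‖) ^ (-1 - β) ≤ κ ^ γ * (1 - ‖x‖) ^ (-(1 - β) * γ) := by
          apply mul_le_mul_of_nonneg_left _ (by positivity)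
          apply Real.rpow_le_rpow_of_exponent_ge hp (by linarith [norm_nonneg x])
          linarith
      _ = (κ * (1 - ‖x‖) ^ (-(1 - β))) ^ γ := by
          rw [Real.mul_rpow hκ0.le h3.le, ← Real.rpow_mul hp.le]
      _ ≤ u x ^ γ := Real.rpow_le_rpow (by positivity) h4 hγ0
  set s : ℕ → ℝ := fun n => 1 - 1 / ((n : ℝ) + 2) with hs
  have hs0 : ∀ n, 0 < s n := by
    intro n
    have : (1:ℝ) / (n + 2) < 1 := by
      rw [div_lt_one (by positivity)]; linarith [Nat.cast_nonneg (α := ℝ) n]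
    simp only [hs]; linarith
  have hs1 : ∀ n, s n < 1 := by
    intro n
    have : (0:ℝ) < 1 / (n + 2) := by positivity
    simp only [hs]; linarith
  have hslim : Tendsto s atTop (𝓝 1) := by
    have h1 : Tendsto (fun n : ℕ => (1:ℝ) / ((n : ℝ) + 2)) atTop (𝓝 0) := by
      have := (tendsto_one_div_add_atTop_nhds_zero_nat (𝕜 := ℝ)).comp (tendsto_add_atTop_nat 1)
      refine this.congr fun n => ?_
      simp only [Function.comp]; push_cast; ring
    have h2 := h1.const_sub 1
    rw [sub_zero] at h2
    exact h2
  set F : ℕ → EN N → ENNReal := fun n => V.indicator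
    (fun x => ENNReal.ofReal (κ ^ γ * (1 - ‖x‖) ^ (-1 - β) * ph β (s n) x)) with hF
  have hFm : ∀ n, Measurable (F n) := by
    intro n
    refine Measurable.indicator (Measurable.ennreal_ofReal (Measurable.mul (Measurable.const_mul
      (Measurable.pow_const (by fun_prop) _) _) ?_)) hV
    exact ph_comp β _ _ measurable_const measurable_id
  have hFK : ∀ n, ∫⁻ x, F n x ≤ K := by
    intro n
    refine le_trans (lintegral_mono fun x => ?_) (hK (s n) (hs0 n) (hs1 n))
    by_cases hx : x ∈ V
    · simp only [hF, indicator_of_mem hx]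
      apply ENNReal.ofReal_le_ofReal
      exact mul_le_mul_of_nonneg_right (hlow x hx) (ph_nonneg _ _ _)
    · simp [hF, indicator_of_notMem hx]
  have hfat := lintegral_liminf_le (u := atTop) (μ := volume) hFm
  have hlim : liminf (fun n => ∫⁻ x, F n x) atTop ≤ K := by
    calc _ ≤ liminf (fun _ : ℕ => K) atTop := liminf_le_liminf (Eventually.of_forall hFK)
      _ = K := liminf_const K
  have hge : ∫⁻ x, V.indicator (fun x => ENNReal.ofReal (κ ^ γ * (1 - ‖x‖)⁻¹)) x ≤
      ∫⁻ x, liminf (fun n => F n x) atTop := by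
    apply lintegral_mono
    intro x
    by_cases hx : x ∈ V
    · have hx1 : ‖x‖ < 1 := by simpa using hx.1
      have hp : 0 < 1 - ‖x‖ := by linarith
      have ht : Tendsto (fun n => F n x) atTop
          (𝓝 (ENNReal.ofReal (κ ^ γ * (1 - ‖x‖) ^ (-1 - β) * ph β 1 x))) := by
        simp only [hF, indicator_of_mem hx]
        apply ENNReal.tendsto_ofReal
        apply Tendsto.const_mul
        have hc : Continuous fun t : ℝ => ph β t x := by
          unfold ph
          exact ((continuous_id.sub continuous_const).max continuous_const).rpow_const
            fun _ => Or.inr hβ.le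
        exact (hc.tendsto 1).comp hslim
      simp only
      rw [ht.liminf_eq, indicator_of_mem hx]
      apply ENNReal.ofReal_le_ofReal
      rw [mul_assoc]
      apply mul_le_mul_of_nonneg_left _ (by positivity)
      have h1 : (1 - ‖x‖) ^ β ≤ ph β 1 x := by
        unfold ph
        apply Real.rpow_le_rpow hp.le _ hβ.le
        apply le_max_of_le_left
        nlinarith [norm_nonneg x]
      calc (1 - ‖x‖)⁻¹ = (1 - ‖x‖) ^ (-1 - β) * (1 - ‖x‖) ^ β := by
            rw [← Real.rpow_add hp, ← Real.rpow_neg_one]; congr 1; ring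
        _ ≤ _ := mul_le_mul_of_nonneg_left h1 (by positivity)
    · rw [indicator_of_notMem hx]; exact bot_le
  rw [diverge N hN z r0 (κ ^ γ) hr0 (by positivity)] at hge
  exact absurd (hge.trans (hfat.trans hlim)) (not_le.2 hKt)


/-- nonexistence for `(P_g)` when `γ ≥ (2+α)/(2-α)`. -/
theorem statement_10 (N : ℕ) (hN : 3 ≤ N) (α : ℝ) (hα0 : 0 < α) (hα2 : α < 2)
    (γ : ℝ) (hγ : (2 + α) / (2 - α) ≤ γ)
    (g : Metric.sphere (0 : EN N) 1 → ℝ) (hgc : Continuous g) (hg0 : ∀ z, 0 ≤ g z)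
    (hgne : ∃ z, g z ≠ 0) :
    ¬ ∃ u : EN N → ℝ, IsSolutionPg N α γ g u := by
  rintro ⟨u, hu⟩
  obtain ⟨z, hz⟩ := hgne
  have e : α = 2 * (α / 2) := by ring
  rw [e] at hu
  refine main_aux N hN (α / 2) γ (by linarith) (by linarith) ?_ g z
    (lt_of_le_of_ne (hg0 z) (Ne.symm hz)) u hu
  rw [div_le_iff₀ (by linarith)] at hγ
  linarith

end
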